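/- arXiv:1407.2436 — 2 statements merged into one kernel-verified Lean document; each statement's English description precedes it below -/
import Mathlib

section
/- Let λ > 0 and let f be continuous on (0,∞) with ∫₀^∞ y^λ |f(y)|/(1+y²)^{λ+1} dy < ∞. Then the function v defined by v(x,t) = P_t^λ(f)(x) for t > 0 and v(x,0) = f(x) is continuous on (0,∞) × [0,∞) and is λ-harmonic on (0,∞) × (0,∞), i.e. ∂_t² v + ∂_x² v − λ(λ−1)x⁻² v = 0. -/
open MeasureTheory Real Set

/-- The Bessel–Poisson kernel `P_t^λ(x,y)`. -/
noncomputable def besselPoissonKernel (l x y t : ℝ) : ℝ :=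
  2 * l * (x * y) ^ l * t / π *
    ∫ θ in (0:ℝ)..π, Real.sin θ ^ (2 * l - 1) /
      ((x - y) ^ 2 + t ^ 2 + 2 * x * y * (1 - Real.cos θ)) ^ (l + 1)

/-- `D_{λ,x} P_t^λ(x,y)`, where `D_λ = x^λ ∂_x x^{-λ}`. -/
noncomputable def DxBesselPoissonKernel (l x y t : ℝ) : ℝ :=
  -(4 * l * (l + 1) / π) * (x * y) ^ l * t *
    ∫ θ in (0:ℝ)..π, Real.sin θ ^ (2 * l - 1) * (x - y * Real.cos θ) /
      ((x - y) ^ 2 + t ^ 2 + 2 * x * y * (1 - Real.cos θ)) ^ (l + 2)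


structure GoodF (l : ℝ) (f : ℝ → ℝ) : Prop where
  cont : ContinuousOn f (Ioi (0:ℝ))
  int : IntegrableOn (fun y => y ^ l * |f y| / (1 + y ^ 2) ^ (l + 1)) (Ioi (0:ℝ))

noncomputable def DD (x t y θ : ℝ) : ℝ := (x - y) ^ 2 + t ^ 2 + 2 * x * y * (1 - Real.cos θ)

noncomputable def Phi (l : ℝ) (f : ℝ → ℝ) (a : ℝ) (k : ℕ) (p z : ℝ × ℝ) : ℝ :=
  z.1 ^ l * f z.1 * Real.sin z.2 ^ (2 * l - 1) * (z.1 * Real.cos z.2) ^ k *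
    (DD p.1 p.2 z.1 z.2) ^ (-a)

noncomputable def Bnd (l : ℝ) (f : ℝ → ℝ) (z : ℝ × ℝ) : ℝ :=
  (z.1 ^ l * |f z.1| / (1 + z.1 ^ 2) ^ (l + 1)) * Real.sin z.2 ^ (2 * l - 1)

def ZZ : Set (ℝ × ℝ) := Ioi (0:ℝ) ×ˢ Ioo (0:ℝ) π

noncomputable def II (l : ℝ) (f : ℝ → ℝ) (a : ℝ) (k : ℕ) (p : ℝ × ℝ) : ℝ :=
  ∫ z in ZZ, Phi l f a k p z

lemma measZZ : MeasurableSet ZZ := measurableSet_Ioi.prod measurableSet_Ioo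

lemma sin_rpow_int (l : ℝ) (hl : 0 < l) :
    IntegrableOn (fun θ => Real.sin θ ^ (2 * l - 1)) (Ioo (0:ℝ) π) := by
  have half : IntegrableOn (fun θ => Real.sin θ ^ (2 * l - 1)) (Ioc (0:ℝ) (π/2)) := by
    have h1 : IntegrableOn (fun θ : ℝ => (2/π * θ) ^ (2 * l - 1) + 1) (Ioc (0:ℝ) (π/2)) := by
      have h2 : IntervalIntegrable (fun θ : ℝ => (2/π)^(2*l-1) * θ ^ (2 * l - 1) + 1) volume 0 (π/2) := by
        apply IntervalIntegrable.add
        · exact (intervalIntegral.intervalIntegrable_rpow' (by linarith)).const_mul _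
        · exact intervalIntegrable_const
      rw [intervalIntegrable_iff_integrableOn_Ioc_of_le (by positivity)] at h2
      refine h2.congr_fun ?_ measurableSet_Ioc
      intro θ hθ
      simp only
      rw [Real.mul_rpow (by positivity) hθ.1.le]
    refine Integrable.mono' h1 ?_ ?_
    · apply ContinuousOn.aestronglyMeasurable _ measurableSet_Ioc
      apply ContinuousOn.rpow_const Real.continuous_sin.continuousOn
      intro θ hθ
      left
      exact (Real.sin_pos_of_pos_of_lt_pi hθ.1 (by linarith [hθ.2, Real.pi_pos])).ne'
    · refine (ae_restrict_iff' measurableSet_Ioc).2 (Filter.Eventually.of_forall ?_)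
      intro θ hθ
      have hs : 0 < Real.sin θ := Real.sin_pos_of_pos_of_lt_pi hθ.1 (by linarith [hθ.2, Real.pi_pos])
      rw [Real.norm_of_nonneg (by positivity)]
      have h3 : 0 < 2/π * θ := by have := hθ.1; positivity
      rcases le_total 0 (2 * l - 1) with h | h
      · have := Real.rpow_le_one hs.le (Real.sin_le_one θ) h
        have : 0 ≤ (2/π * θ) ^ (2 * l - 1) := by positivity
        linarith
      · have := Real.rpow_le_rpow_of_nonpos h3 (Real.mul_le_sin hθ.1.le hθ.2) h
        linarith
  have hI : IntervalIntegrable (fun θ => Real.sin θ ^ (2 * l - 1)) volume 0 (π/2) := by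
    rw [intervalIntegrable_iff_integrableOn_Ioc_of_le (by positivity)]; exact half
  have h2 := hI.comp_sub_left π
  simp only [Real.sin_pi_sub] at h2
  have h3 : IntervalIntegrable (fun θ => Real.sin θ ^ (2 * l - 1)) volume 0 π := by
    refine hI.trans ?_
    convert h2.symm using 1 <;> ring
  rw [intervalIntegrable_iff_integrableOn_Ioo_of_le Real.pi_pos.le] at h3
  exact h3

lemma Bnd_int {l : ℝ} (hl : 0 < l) {f : ℝ → ℝ} (hf : GoodF l f) : IntegrableOn (Bnd l f) ZZ := by
  have := Integrable.mul_prod hf.int (sin_rpow_int l hl)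
  rw [Measure.prod_restrict] at this
  exact this

lemma DD_ge {x t y θ : ℝ} (hx : 0 < x) (hy : 0 < y) : (x - y)^2 + t^2 ≤ DD x t y θ := by
  unfold DD
  have : 0 ≤ 2 * x * y * (1 - Real.cos θ) := mul_nonneg (by positivity) (by linarith [Real.cos_le_one θ])
  linarith

lemma DD_pos {x t y θ : ℝ} (hx : 0 < x) (ht : 0 < t) (hy : 0 < y) : 0 < DD x t y θ := by
  have := DD_ge (t := t) (θ := θ) hx hy
  have : 0 < t^2 := by positivity
  nlinarith [sq_nonneg (x-y)]

lemma key_lower {x y Q M τ : ℝ} (hτ : 0 < τ) (hx : 0 < x) (hxM : x ≤ M) (h1 : τ^2 ≤ Q) (h2 : (x-y)^2 ≤ Q) :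
    1 + y^2 ≤ (2 + (1 + 2*M^2)/τ^2) * Q := by
  have h3 : (1 + 2*M^2) ≤ (1 + 2*M^2)/τ^2 * Q := by
    rw [div_mul_eq_mul_div, le_div_iff₀ (by positivity)]
    exact mul_le_mul_of_nonneg_left h1 (by positivity)
  have : x^2 ≤ M^2 := by nlinarith
  nlinarith [sq_nonneg (y - 2*x)]

lemma rpow_bound {l a : ℝ} {k : ℕ} (ha : l + 1 + k/2 ≤ a) (hl : 0 < l) {K y Q q : ℝ} (hK : 0 < K) (hQ : 0 < Q)
    (h : 1 + y^2 ≤ K * Q) (hq : |q| ≤ |y|) :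
    |q|^k * Q^(-a) ≤ K^a * (1 + y^2)^(-(l+1)) := by
  have hapos : 0 ≤ a := by have : (0:ℝ) ≤ k/2 := by positivity
                           linarith
  have e1 : |q| ≤ (1+y^2)^((1:ℝ)/2) := by
    rw [← Real.sqrt_eq_rpow]
    apply hq.trans
    rw [← Real.sqrt_sq_eq_abs]
    exact Real.sqrt_le_sqrt (by linarith)
  have e2 : |q|^k ≤ (1+y^2)^((k:ℝ)/2) := by
    calc |q|^k ≤ ((1+y^2)^((1:ℝ)/2))^k := pow_le_pow_left₀ (abs_nonneg _) e1 k
      _ = _ := by rw [← Real.rpow_natCast, ← Real.rpow_mul (by positivity)]; congr 1; ring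
  have e3 : Q^(-a) ≤ K^a * (1+y^2)^(-a) := by
    have : (K*Q)^(-a) ≤ (1+y^2)^(-a) := Real.rpow_le_rpow_of_nonpos (by positivity) h (by linarith)
    rw [Real.mul_rpow hK.le hQ.le] at this
    calc Q^(-a) = K^a * (K^(-a) * Q^(-a)) := by
          rw [← mul_assoc, ← Real.rpow_add hK]; simp
      _ ≤ _ := mul_le_mul_of_nonneg_left this (by positivity)
  calc |q|^k * Q^(-a) ≤ (1+y^2)^((k:ℝ)/2) * (K^a * (1+y^2)^(-a)) := by gcongr
    _ = K^a * ((1+y^2)^((k:ℝ)/2 + -a)) := by rw [Real.rpow_add (by positivity)]; ring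
    _ ≤ _ := by
      apply mul_le_mul_of_nonneg_left _ (by positivity)
      apply Real.rpow_le_rpow_of_exponent_le (by nlinarith [sq_nonneg y])
      linarith

lemma Phi_bound {l a : ℝ} {k : ℕ} (ha : l + 1 + k/2 ≤ a) (hl : 0 < l) {f : ℝ → ℝ} {K : ℝ} (hK : 0 < K) {p z : ℝ × ℝ}
    (hz : z ∈ ZZ) (hD : 0 < DD p.1 p.2 z.1 z.2)
    (h : 1 + z.1^2 ≤ K * DD p.1 p.2 z.1 z.2) : |Phi l f a k p z| ≤ K^a * Bnd l f z := by
  obtain ⟨hy, hθ⟩ := hz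
  have hy : 0 < z.1 := hy
  have hs : 0 < Real.sin z.2 := Real.sin_pos_of_pos_of_lt_pi hθ.1 hθ.2
  have := rpow_bound ha hl hK hD h (q := z.1 * Real.cos z.2) (by
    rw [abs_mul]; exact mul_le_of_le_one_right (abs_nonneg _) (Real.abs_cos_le_one _))
  unfold Phi Bnd
  rw [abs_mul, abs_mul, abs_mul, abs_mul, abs_pow, abs_of_pos (Real.rpow_pos_of_pos hy _),
    abs_of_pos (Real.rpow_pos_of_pos hs _), abs_of_pos (Real.rpow_pos_of_pos hD _), div_eq_mul_inv,
    ← Real.rpow_neg (by positivity)]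
  calc _ = (z.1^l * |f z.1| * Real.sin z.2^(2*l-1)) * (|z.1 * Real.cos z.2|^k * DD p.1 p.2 z.1 z.2 ^ (-a)) := by ring
    _ ≤ (z.1^l * |f z.1| * Real.sin z.2^(2*l-1)) * (K ^ a * (1 + z.1^2)^(-(l+1))) :=
        mul_le_mul_of_nonneg_left this (by positivity)
    _ = _ := by ring

lemma Phi_meas {l a : ℝ} {k : ℕ} {f : ℝ → ℝ} (hf : GoodF l f) {p : ℝ × ℝ} (hx : 0 < p.1) (ht : 0 < p.2) :
    AEStronglyMeasurable (Phi l f a k p) (volume.restrict ZZ) := by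
  apply ContinuousOn.aestronglyMeasurable _ measZZ
  unfold Phi
  have hfc : ContinuousOn (fun z : ℝ × ℝ => f z.1) ZZ :=
    hf.cont.comp continuousOn_fst (fun z hz => hz.1)
  apply ContinuousOn.mul (ContinuousOn.mul (ContinuousOn.mul (ContinuousOn.mul _ hfc) _) _)
  · apply ContinuousOn.rpow_const
    · unfold DD; fun_prop
    · intro z hz; left; exact (DD_pos hx ht hz.1).ne'
  · apply ContinuousOn.rpow_const continuousOn_fst
    intro z hz; left; exact (show 0 < z.1 from hz.1).ne'
  · apply ContinuousOn.rpow_const (by fun_prop)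
    intro z hz; left; exact (Real.sin_pos_of_pos_of_lt_pi hz.2.1 hz.2.2).ne'
  · fun_prop

lemma DD_lower {x t y θ M τ : ℝ} (hτ : 0 < τ) (hx : 0 < x) (hxM : x ≤ M) (ht : τ ≤ t) (hy : 0 < y) :
    1 + y^2 ≤ (2 + (1 + 2*M^2)/τ^2) * DD x t y θ := by
  have h := DD_ge (t := t) (θ := θ) hx hy
  apply key_lower hτ hx hxM
  · nlinarith [sq_nonneg (x-y)]
  · nlinarith [sq_nonneg t]

lemma Phi_bound2 {l a : ℝ} {k : ℕ} (ha : l + 1 + k/2 ≤ a) (hl : 0 < l) {f : ℝ → ℝ} {p z : ℝ × ℝ} {M τ : ℝ}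
    (hτ : 0 < τ) (hx : 0 < p.1) (hxM : p.1 ≤ M) (ht : τ ≤ p.2)
    (hz : z ∈ ZZ) : |Phi l f a k p z| ≤ (2 + (1 + 2*M^2)/τ^2)^a * Bnd l f z :=
  Phi_bound ha hl (by positivity) hz (DD_pos hx (hτ.trans_le ht) hz.1) (DD_lower hτ hx hxM ht hz.1)

lemma Phi_int {l a : ℝ} {k : ℕ} (ha : l + 1 + k/2 ≤ a) (hl : 0 < l) {f : ℝ → ℝ} (hf : GoodF l f)
    {p : ℝ × ℝ} (hx : 0 < p.1) (ht : 0 < p.2) : IntegrableOn (Phi l f a k p) ZZ := by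
  refine Integrable.mono' ((Bnd_int hl hf).const_mul ((2 + (1 + 2*p.1^2)/p.2^2)^a)) (Phi_meas hf hx ht) ?_
  refine (ae_restrict_iff' measZZ).2 (Filter.Eventually.of_forall ?_)
  intro z hz
  exact Phi_bound2 ha hl ht hx le_rfl le_rfl hz

noncomputable def mkD (a x t A B : ℝ) : ℝ × ℝ →L[ℝ] ℝ :=
  (-2*a*(x * A - B)) • ContinuousLinearMap.fst ℝ ℝ ℝ + (-2*a*(t*A)) • ContinuousLinearMap.snd ℝ ℝ ℝ

lemma Phi_hasFDeriv {l a : ℝ} {k : ℕ} {f : ℝ → ℝ} {p z : ℝ × ℝ} (hx : 0 < p.1) (ht : 0 < p.2) (hz : z ∈ ZZ) :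
    HasFDerivAt (fun p => Phi l f a k p z)
      (mkD a p.1 p.2 (Phi l f (a+1) k p z) (Phi l f (a+1) (k+1) p z)) p := by
  have hD := DD_pos (θ := z.2) hx ht hz.1
  have h1 : HasFDerivAt (fun p : ℝ × ℝ => DD p.1 p.2 z.1 z.2)
      ((2 * (p.1 - z.1 * Real.cos z.2)) • ContinuousLinearMap.fst ℝ ℝ ℝ
        + (2 * p.2) • ContinuousLinearMap.snd ℝ ℝ ℝ) p := by
    unfold DD
    have hf := hasFDerivAt_fst (𝕜 := ℝ) (p := p) (E := ℝ) (F := ℝ)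
    have hs := hasFDerivAt_snd (𝕜 := ℝ) (p := p) (E := ℝ) (F := ℝ)
    refine ((((hf.sub_const z.1).pow 2).add (hs.pow 2)).add
      (((hf.const_mul 2).mul_const z.1).mul_const (1 - Real.cos z.2))).congr_fderiv ?_
    ext <;> simp <;> ring
  have h2 := (h1.rpow_const (p := -a) (Or.inl hD.ne')).const_mul
    (z.1 ^ l * f z.1 * Real.sin z.2 ^ (2 * l - 1) * (z.1 * Real.cos z.2) ^ k)
  refine h2.congr_fderiv ?_
  unfold Phi mkD
  rw [show -(a+1) = -a - 1 by ring]
  ext <;> simp <;> ring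

lemma mkD_norm (a x t A B M : ℝ) (hx : |x| ≤ M) (ht : |t| ≤ M) :
    ‖mkD a x t A B‖ ≤ 2*|a| *(2*M*|A| + |B|) := by
  have h1 : ‖ContinuousLinearMap.fst ℝ ℝ ℝ‖ ≤ 1 := ContinuousLinearMap.norm_fst_le ..
  have h2 : ‖ContinuousLinearMap.snd ℝ ℝ ℝ‖ ≤ 1 := ContinuousLinearMap.norm_snd_le ..
  unfold mkD
  refine (norm_add_le _ _).trans ?_
  rw [norm_smul, norm_smul]
  have e1 : ‖-2*a*(x * A - B)‖ ≤ 2*|a| *(M*|A| + |B|) := by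
    rw [Real.norm_eq_abs, abs_mul, abs_mul]
    norm_num
    have : |x*A-B| ≤ M*|A|+|B| := by
      refine (abs_sub _ _).trans ?_
      rw [abs_mul]; gcongr
    gcongr
  have e2 : ‖-2*a*(t * A)‖ ≤ 2*|a| *(M*|A|) := by
    rw [Real.norm_eq_abs, abs_mul, abs_mul, abs_mul]
    norm_num
    gcongr
  have hM : 0 ≤ M := (abs_nonneg _).trans hx
  calc _ ≤ (2*|a| *(M*|A| + |B|)) * 1 + (2*|a| *(M*|A|)) * 1 := by gcongr
    _ = _ := by ring

lemma II_hasFDeriv {l a : ℝ} {k : ℕ} (ha : l + 1 + k/2 ≤ a) (hl : 0 < l) {f : ℝ → ℝ} (hf : GoodF l f)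
    {p : ℝ × ℝ} (hx : 0 < p.1) (ht : 0 < p.2) :
    HasFDerivAt (II l f a k) (mkD a p.1 p.2 (II l f (a+1) k p) (II l f (a+1) (k+1) p)) p := by
  have ha1 : l + 1 + (k:ℝ)/2 ≤ a+1 := by linarith
  have ha2 : l + 1 + ((k+1:ℕ):ℝ)/2 ≤ a+1 := by push_cast; linarith
  set s : Set (ℝ × ℝ) := Ioo (p.1/2) (p.1+1) ×ˢ Ioo (p.2/2) (p.2+1) with hs
  have hso : s ∈ nhds p := by
    apply (isOpen_Ioo.prod isOpen_Ioo).mem_nhds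
    constructor <;> constructor <;> simp <;> linarith
  set M := p.1 + p.2 + 1
  set C := (2 + (1 + 2*M^2)/(p.2/2)^2)^(a+1)
  have key := hasFDerivAt_integral_of_dominated_of_fderiv_le (𝕜 := ℝ) (μ := volume.restrict ZZ)
    (F := fun p z => Phi l f a k p z)
    (F' := fun p z => mkD a p.1 p.2 (Phi l f (a+1) k p z) (Phi l f (a+1) (k+1) p z)) (x₀ := p) (s := s)
    (bound := fun z => 2*|a| *(2*M*(C*Bnd l f z) + C * Bnd l f z)) hso ?_ (Phi_int ha hl hf hx ht) ?_ ?_ ?_ ?_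
  · refine key.congr_fderiv ?_
    have i1 := Phi_int ha1 hl hf hx ht
    have i2 := Phi_int ha2 hl hf hx ht
    have j1 : IntegrableOn (fun z => -2*a*(p.1 * Phi l f (a+1) k p z - Phi l f (a+1) (k+1) p z)) ZZ :=
      ((i1.const_mul p.1).sub i2).const_mul _
    have j2 : IntegrableOn (fun z => -2*a*(p.2 * Phi l f (a+1) k p z)) ZZ :=
      (i1.const_mul p.2).const_mul _
    unfold mkD
    rw [integral_add (j1.smul_const _) (j2.smul_const _), integral_smul_const, integral_smul_const]
    rw [integral_const_mul, integral_const_mul, integral_const_mul, integral_sub (i1.const_mul p.1) i2,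
      integral_const_mul]
    rfl
  · filter_upwards [hso] with q hq
    exact Phi_meas hf (by have := hq.1.1; linarith) (by have := hq.2.1; linarith)
  · have i1 := Phi_int ha1 hl hf hx ht
    have i2 := Phi_int ha2 hl hf hx ht
    have j1 : IntegrableOn (fun z => -2*a*(p.1 * Phi l f (a+1) k p z - Phi l f (a+1) (k+1) p z)) ZZ :=
      ((i1.const_mul p.1).sub i2).const_mul _
    have j2 : IntegrableOn (fun z => -2*a*(p.2 * Phi l f (a+1) k p z)) ZZ :=
      (i1.const_mul p.2).const_mul _
    exact (j1.smul_const (ContinuousLinearMap.fst ℝ ℝ ℝ)).1.add (j2.smul_const (ContinuousLinearMap.snd ℝ ℝ ℝ)).1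
  · refine (ae_restrict_iff' measZZ).2 (Filter.Eventually.of_forall ?_)
    intro z hz q hq
    have q1 : 0 < q.1 := by have := hq.1.1; linarith
    have q2 : p.2/2 ≤ q.2 := hq.2.1.le
    have q3 : q.1 ≤ M := by have := hq.1.2; simp only [M]; linarith
    have q4 : q.2 ≤ M := by have := hq.2.2; simp only [M]; linarith
    refine (mkD_norm _ _ _ _ _ M ?_ ?_).trans ?_
    · rw [abs_of_pos q1]; exact q3
    · rw [abs_of_nonneg (by linarith)]; exact q4
    · have b1 := Phi_bound2 ha1 hl (f := f) (half_pos ht) q1 q3 q2 hz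
      have b2 := Phi_bound2 ha2 hl (f := f) (half_pos ht) q1 q3 q2 hz
      have : 0 ≤ M := by simp only [M]; linarith
      gcongr
  · have hB := (Bnd_int hl hf)
    exact ((((hB.const_mul C).const_mul (2*M)).add (hB.const_mul C)).const_mul (2*|a|))
  · refine (ae_restrict_iff' measZZ).2 (Filter.Eventually.of_forall ?_)
    intro z hz q hq
    exact Phi_hasFDeriv (by have := hq.1.1; linarith) (by have := hq.2.1; linarith) hz

def QQ : Set (ℝ × ℝ) := Ioi (0:ℝ) ×ˢ Ioi (0:ℝ)
lemma QQ_open : IsOpen QQ := isOpen_Ioi.prod isOpen_Ioi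

lemma II_contDiff {l : ℝ} (hl : 0 < l) {f : ℝ → ℝ} (hf : GoodF l f) (n : ℕ) :
    ∀ (a : ℝ) (k : ℕ), l + 1 + k/2 ≤ a → ContDiffOn ℝ n (II l f a k) QQ := by
  induction n with
  | zero =>
    intro a k ha
    simp only [Nat.cast_zero, contDiffOn_zero]
    intro p hp
    exact (II_hasFDeriv ha hl hf hp.1 hp.2).continuousAt.continuousWithinAt
  | succ n ih =>
    intro a k ha
    push_cast
    rw [contDiffOn_succ_iff_fderiv_of_isOpen QQ_open]
    refine ⟨fun p hp => (II_hasFDeriv ha hl hf hp.1 hp.2).differentiableAt.differentiableWithinAt,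
      by simp, ?_⟩
    have e : ContDiffOn ℝ n (fun p : ℝ × ℝ => mkD a p.1 p.2 (II l f (a+1) k p) (II l f (a+1) (k+1) p)) QQ := by
      have c1 := ih (a+1) k (by linarith)
      have c2 := ih (a+1) (k+1) (by push_cast; linarith)
      unfold mkD
      have f1 : ContDiffOn ℝ n (fun p : ℝ × ℝ => p.1) QQ := contDiff_fst.contDiffOn
      have f2 : ContDiffOn ℝ n (fun p : ℝ × ℝ => p.2) QQ := contDiff_snd.contDiffOn
      exact ((contDiffOn_const.mul ((f1.mul c1).sub c2)).smul contDiffOn_const).add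
        ((contDiffOn_const.mul (f2.mul c1)).smul contDiffOn_const)
    exact e.congr (fun p hp => (II_hasFDeriv ha hl hf hp.1 hp.2).fderiv)

lemma II_deriv_x {l a : ℝ} {k : ℕ} (ha : l + 1 + k/2 ≤ a) (hl : 0 < l) {f : ℝ → ℝ} (hf : GoodF l f)
    {x t : ℝ} (hx : 0 < x) (ht : 0 < t) :
    HasDerivAt (fun x => II l f a k (x, t))
      (-2*a*(x * II l f (a+1) k (x,t) - II l f (a+1) (k+1) (x,t))) x := by
  have h := (II_hasFDeriv (p := (x,t)) ha hl hf hx ht).comp_hasDerivAt x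
    ((hasDerivAt_id x).prodMk (hasDerivAt_const x t))
  refine h.congr_deriv ?_
  simp [mkD]

lemma II_deriv_t {l a : ℝ} {k : ℕ} (ha : l + 1 + k/2 ≤ a) (hl : 0 < l) {f : ℝ → ℝ} (hf : GoodF l f)
    {x t : ℝ} (hx : 0 < x) (ht : 0 < t) :
    HasDerivAt (fun t => II l f a k (x, t)) (-2*a*(t * II l f (a+1) k (x,t))) t := by
  have h := (II_hasFDeriv (p := (x,t)) ha hl hf hx ht).comp_hasDerivAt t
    ((hasDerivAt_const t x).prodMk (hasDerivAt_id t))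
  refine h.congr_deriv ?_
  simp [mkD]

lemma V_formula {l : ℝ} (hl : 0 < l) {f : ℝ → ℝ} (hf : GoodF l f) {x t : ℝ} (hx : 0 < x) (ht : 0 < t) :
    ∫ y in Ioi (0:ℝ), besselPoissonKernel l x y t * f y = 2 * l / π * x ^ l * t * II l f (l+1) 0 (x,t) := by
  have hi := Phi_int (k := 0) (p := (x,t)) (a := l+1) (by simp) hl hf hx ht
  unfold II ZZ
  rw [Measure.volume_eq_prod, setIntegral_prod _ hi, ← integral_const_mul]
  apply setIntegral_congr_fun measurableSet_Ioi
  intro y hy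
  have hy : 0 < y := hy
  simp only [besselPoissonKernel]
  rw [intervalIntegral.integral_of_le Real.pi_pos.le, integral_Ioc_eq_integral_Ioo,
    ← integral_const_mul, ← integral_const_mul, ← integral_mul_const]
  apply setIntegral_congr_fun measurableSet_Ioo
  intro θ hθ
  have hD := DD_pos (θ := θ) hx ht hy
  simp only [Phi]
  rw [Real.rpow_neg hD.le, Real.mul_rpow hx.le hy.le]
  unfold DD
  simp only [pow_zero]
  ring

lemma inner_zero {l : ℝ} (hl : 0 < l) {x t y : ℝ} (hx : 0 < x) (ht : 0 < t) (hy : 0 < y) :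
    ∫ θ in Ioo (0:ℝ) π, (2 * l * Real.sin θ ^ (2*l-1) * Real.cos θ * DD x t y θ ^ (-(l+2))
      - (l+2) * (2 * x * y) * Real.sin θ ^ (2*l-1) * (1 - Real.cos θ ^2) * DD x t y θ ^ (-(l+3))) = 0 := by
  rw [← integral_Ioc_eq_integral_Ioo, ← intervalIntegral.integral_of_le Real.pi_pos.le]
  have hDc : Continuous (fun θ => DD x t y θ) := by unfold DD; fun_prop
  have hDr : ∀ b : ℝ, Continuous (fun θ => DD x t y θ ^ b) := fun b =>
    hDc.rpow_const (fun θ => Or.inl (DD_pos hx ht hy).ne')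
  rw [intervalIntegral.integral_eq_sub_of_hasDerivAt_of_le Real.pi_pos.le
    (f := fun θ => Real.sin θ ^ (2*l) * DD x t y θ ^ (-(l+2)))]
  · simp [Real.zero_rpow (show 2*l ≠ 0 by positivity)]
  · apply Continuous.continuousOn
    apply Continuous.mul _ (hDr _)
    exact Real.continuous_sin.rpow_const (fun θ => Or.inr (by positivity))
  · intro θ hθ
    have hs : 0 < Real.sin θ := Real.sin_pos_of_pos_of_lt_pi hθ.1 hθ.2
    have h1 : HasDerivAt (fun θ => DD x t y θ) (2 * x * y * Real.sin θ) θ := by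
      unfold DD
      refine ((((Real.hasDerivAt_cos θ).const_sub 1).const_mul (2*x*y)).const_add _).congr_deriv ?_
      ring
    have h2 := ((Real.hasDerivAt_sin θ).rpow_const (p := 2*l) (Or.inl hs.ne')).mul
      (h1.rpow_const (p := -(l+2)) (Or.inl (DD_pos hx ht hy).ne'))
    refine h2.congr_deriv ?_
    have e1 : Real.sin θ ^ (2*l) = Real.sin θ ^ (2*l-1) * Real.sin θ := by
      conv_rhs => rw [← Real.rpow_add_one hs.ne']
      congr 1; ring
    have e2 : 1 - Real.cos θ ^ 2 = Real.sin θ ^ 2 := by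
      have := Real.sin_sq_add_cos_sq θ; linarith
    rw [e1, e2, show -(l+2) - 1 = -(l+3) by ring]
    ring
  · have hI : IntervalIntegrable (fun θ => Real.sin θ ^ (2 * l - 1)) volume 0 π := by
      rw [intervalIntegrable_iff_integrableOn_Ioo_of_le Real.pi_pos.le]; exact sin_rpow_int l hl
    have c : Continuous (fun θ => (2 * l * Real.cos θ * DD x t y θ ^ (-(l+2))
      - (l+2) * (2 * x * y) * (1 - Real.cos θ ^2) * DD x t y θ ^ (-(l+3)))) := by
      have := hDr (-(l+2))
      have := hDr (-(l+3))
      fun_prop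
    have := hI.mul_continuousOn c.continuousOn
    refine this.congr ?_
    intro θ hθ
    simp only
    ring

lemma relation {l : ℝ} (hl : 0 < l) {f : ℝ → ℝ} (hf : GoodF l f) {x t : ℝ} (hx : 0 < x) (ht : 0 < t) :
    l * II l f (l+2) 1 (x,t) - (l+2) * x * (II l f (l+2) 0 (x,t) - (x^2+t^2) * II l f (l+3) 0 (x,t)
      + 2 * x * II l f (l+3) 1 (x,t) - II l f (l+3) 2 (x,t)) = 0 := by
  have i21 := Phi_int (k := 1) (p := (x,t)) (a := l+2) (by norm_num; linarith) hl hf hx ht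
  have i20 := Phi_int (k := 0) (p := (x,t)) (a := l+2) (by norm_num) hl hf hx ht
  have i30 := Phi_int (k := 0) (p := (x,t)) (a := l+3) (by norm_num) hl hf hx ht
  have i31 := Phi_int (k := 1) (p := (x,t)) (a := l+3) (by norm_num; linarith) hl hf hx ht
  have i32 := Phi_int (k := 2) (p := (x,t)) (a := l+3) (by norm_num; linarith) hl hf hx ht
  have e : ∫ z in ZZ, (l * Phi l f (l+2) 1 (x,t) z - (l+2) * x * (Phi l f (l+2) 0 (x,t) z
      - (x^2+t^2) * Phi l f (l+3) 0 (x,t) z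
      + 2 * x * Phi l f (l+3) 1 (x,t) z - Phi l f (l+3) 2 (x,t) z)) =
      l * II l f (l+2) 1 (x,t) - (l+2) * x * (II l f (l+2) 0 (x,t) - (x^2+t^2) * II l f (l+3) 0 (x,t)
      + 2 * x * II l f (l+3) 1 (x,t) - II l f (l+3) 2 (x,t)) := by
    have j1 : IntegrableOn (fun z => Phi l f (l+2) 0 (x,t) z - (x^2+t^2) * Phi l f (l+3) 0 (x,t) z) ZZ :=
      i20.sub (i30.const_mul (x^2+t^2))
    have j2 : IntegrableOn (fun z => Phi l f (l+2) 0 (x,t) z - (x^2+t^2) * Phi l f (l+3) 0 (x,t) z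
        + 2 * x * Phi l f (l+3) 1 (x,t) z) ZZ := j1.add (i31.const_mul (2*x))
    have j3 : IntegrableOn (fun z => Phi l f (l+2) 0 (x,t) z - (x^2+t^2) * Phi l f (l+3) 0 (x,t) z
        + 2 * x * Phi l f (l+3) 1 (x,t) z - Phi l f (l+3) 2 (x,t) z) ZZ := j2.sub i32
    unfold II
    rw [integral_sub (i21.const_mul l) (j3.const_mul ((l+2)*x)), integral_const_mul, integral_const_mul,
      integral_sub j2 i32, integral_add j1 (i31.const_mul (2*x)), integral_sub i20 (i30.const_mul _),
      integral_const_mul, integral_const_mul]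
  have hint : IntegrableOn (fun z => (l * Phi l f (l+2) 1 (x,t) z - (l+2) * x * (Phi l f (l+2) 0 (x,t) z
      - (x^2+t^2) * Phi l f (l+3) 0 (x,t) z
      + 2 * x * Phi l f (l+3) 1 (x,t) z - Phi l f (l+3) 2 (x,t) z))) ZZ :=
    (i21.const_mul l).sub ((((i20.sub (i30.const_mul (x^2+t^2))).add (i31.const_mul (2*x))).sub i32).const_mul _)
  rw [← e]
  unfold ZZ
  rw [Measure.volume_eq_prod, setIntegral_prod _ hint]
  rw [← setIntegral_congr_fun (f := fun _ => (0:ℝ)) measurableSet_Ioi]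
  · simp
  intro y hy
  have hy : 0 < y := hy
  simp only
  have h0 := inner_zero hl hx ht hy
  refine Eq.trans (b := y^l * f y * (y/2) * 0) (by ring) ?_
  refine Eq.trans (congrArg _ h0.symm) ?_
  rw [← integral_const_mul]
  apply setIntegral_congr_fun measurableSet_Ioo
  intro θ hθ
  have hD := DD_pos (θ := θ) hx ht hy
  simp only [Phi]
  have e2 : DD x t y θ ^ (-(l+2)) = DD x t y θ ^ (-(l+3)) * DD x t y θ := by
    conv_rhs => rw [← Real.rpow_add_one hD.ne']
    congr 1; ring
  rw [e2]
  generalize DD x t y θ ^ (-(l+3)) = E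
  unfold DD
  ring

lemma pde {l : ℝ} (hl : 0 < l) {f : ℝ → ℝ} (hf : GoodF l f) {x t : ℝ} (hx : 0 < x) (ht : 0 < t) (V : ℝ × ℝ → ℝ)
    (hV : ∀ x t : ℝ, 0 < x → 0 < t → V (x,t) = 2 * l / π * x ^ l * t * II l f (l+1) 0 (x,t)) :
    deriv (deriv (fun s => V (x, s))) t + deriv (deriv (fun z => V (z, t))) x
        - l * (l - 1) / x ^ 2 * V (x, t) = 0 := by
  set c := 2 * l / π with hc
  have a1 : l + 1 + ((0:ℕ):ℝ)/2 ≤ l + 1 := by norm_num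
  have a2 : l + 1 + ((0:ℕ):ℝ)/2 ≤ l + 1 + 1 := by norm_num
  have a3 : l + 1 + ((0+1:ℕ):ℝ)/2 ≤ l + 1 + 1 := by norm_num
  -- time derivatives
  have dt1 : ∀ s, 0 < s → HasDerivAt (fun s => V (x,s))
      (c * x^l * (II l f (l+1) 0 (x,s) + s * (-2*(l+1)*(s * II l f (l+1+1) 0 (x,s))))) s := by
    intro s hs
    have h := ((hasDerivAt_id s).mul (II_deriv_t a1 hl hf hx hs)).const_mul (c * x^l)
    refine (h.congr_deriv ?_).congr_of_eventuallyEq ?_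
    · simp
    · filter_upwards [Ioi_mem_nhds hs] with r hr
      rw [hV x r hx hr]; simp; ring
  have dt2 : HasDerivAt (deriv (fun s => V (x,s)))
      (c * x^l * ((-2*(l+1)*(t * II l f (l+1+1) 0 (x,t))) + (-2*(l+1)) *
        (2 * t * II l f (l+1+1) 0 (x,t) + t^2 * (-2*(l+1+1)*(t * II l f (l+1+1+1) 0 (x,t)))))) t := by
    have h := ((II_deriv_t a1 hl hf hx ht).add
      ((((hasDerivAt_id t).pow 2).mul (II_deriv_t a2 hl hf hx ht)).const_mul (-2*(l+1)))).const_mul (c * x^l)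
    refine (h.congr_deriv ?_).congr_of_eventuallyEq ?_
    · simp
    · filter_upwards [Ioi_mem_nhds ht] with r hr
      rw [(dt1 r hr).deriv]; simp only [Pi.add_apply, Pi.mul_apply, Pi.pow_apply, id]; ring
  have dx1 : ∀ z, 0 < z → HasDerivAt (fun z => V (z,t))
      (c * t * (l * z^(l-1) * II l f (l+1) 0 (z,t) + z^l *
        (-2*(l+1)*(z * II l f (l+1+1) 0 (z,t) - II l f (l+1+1) 1 (z,t))))) z := by
    intro z hz
    have h := ((Real.hasDerivAt_rpow_const (x := z) (p := l) (Or.inl hz.ne')).mul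
      (II_deriv_x a1 hl hf hz ht)).const_mul (c * t)
    refine (h.congr_deriv ?_).congr_of_eventuallyEq ?_
    · simp
    · filter_upwards [Ioi_mem_nhds hz] with r hr
      rw [hV r t hr ht]; simp; ring
  have dx2 : HasDerivAt (deriv (fun z => V (z,t)))
      (c * t * ((l * ((l-1) * x^(l-1-1)) * II l f (l+1) 0 (x,t) + l * x^(l-1) *
        (-2*(l+1)*(x * II l f (l+1+1) 0 (x,t) - II l f (l+1+1) 1 (x,t)))) +
       (l * x^(l-1) * (-2*(l+1)*(x * II l f (l+1+1) 0 (x,t) - II l f (l+1+1) 1 (x,t)))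
        + x^l * (-2*(l+1) * ((1 * II l f (l+1+1) 0 (x,t) + x *
          (-2*(l+1+1)*(x * II l f (l+1+1+1) 0 (x,t) - II l f (l+1+1+1) 1 (x,t)))) -
          (-2*(l+1+1)*(x * II l f (l+1+1+1) 1 (x,t) - II l f (l+1+1+1) 2 (x,t)))))))) x := by
    have h1 := ((Real.hasDerivAt_rpow_const (x := x) (p := l-1) (Or.inl hx.ne')).const_mul l).mul
      (II_deriv_x a1 hl hf hx ht)
    have h2 := (Real.hasDerivAt_rpow_const (x := x) (p := l) (Or.inl hx.ne')).mul
      ((((hasDerivAt_id x).mul (II_deriv_x a2 hl hf hx ht)).sub (II_deriv_x a3 hl hf hx ht)).const_mul (-2*(l+1)))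
    have h := (h1.add h2).const_mul (c*t)
    refine (h.congr_deriv ?_).congr_of_eventuallyEq ?_
    · simp
    · filter_upwards [Ioi_mem_nhds hx] with r hr
      rw [(dx1 r hr).deriv]; simp
  rw [dt2.deriv, dx2.deriv, hV x t hx ht]
  have R := relation hl hf hx ht
  rw [show l+1+1 = l+2 by ring, show l+2+1 = l+3 by ring]
  have r1 : x^(l-1) = x^(l-1-1) * x := by
    rw [← Real.rpow_add_one hx.ne']; congr 1; ring
  have r2 : x^l = x^(l-1-1) * x^2 := by
    rw [← Real.rpow_natCast, ← Real.rpow_add hx]; congr 1; push_cast; ring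
  rw [r1, r2]
  generalize x^(l-1-1) = E at *
  generalize II l f (l+2) 1 (x,t) = B21 at *
  generalize II l f (l+2) 0 (x,t) = B20 at *
  generalize II l f (l+3) 0 (x,t) = B30 at *
  generalize II l f (l+3) 1 (x,t) = B31 at *
  generalize II l f (l+3) 2 (x,t) = B32 at *
  generalize II l f (l+1) 0 (x,t) = B10 at *
  have hx0 := hx.ne'
  have hq : l * (l-1) / x^2 * (c * (E * x^2) * t * B10) = l * (l-1) * c * E * t * B10 := by
    field_simp
  rw [hq]
  linear_combination (4 * (l+1)) * t * c * E * x * R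

lemma rad_deriv {l A : ℝ} (hl : 0 < l) (hA : 0 < A) {b : ℝ} (hb : 0 < b) :
    HasDerivAt (fun b : ℝ => (1/(2*l*A)) * (b^2/(A+b^2))^l)
      (b^(2*l-1) * (A + b^2)^(-(l+1))) b := by
  have hAb : 0 < A + b^2 := by positivity
  have h1 : HasDerivAt (fun b : ℝ => b^2/(A+b^2)) (2*A*b/(A+b^2)^2) b := by
    refine (((hasDerivAt_id b).pow 2).div (((hasDerivAt_id b).pow 2).const_add A) hAb.ne').congr_deriv ?_
    simp
    ring
  have h2 := (h1.rpow_const (p := l) (Or.inl (by positivity))).const_mul (1/(2*l*A))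
  refine h2.congr_deriv ?_
  have e1 : (b^2/(A+b^2))^(l-1) = b^(2*l-1) / b * ((A+b^2)^(-(l+1)) * (A+b^2)^2) := by
    rw [Real.div_rpow (by positivity) hAb.le, div_eq_mul_inv, ← Real.rpow_neg hAb.le]
    congr 1
    · rw [← Real.rpow_natCast, ← Real.rpow_mul hb.le, ← Real.rpow_sub_one hb.ne']
      congr 1; push_cast; ring
    · rw [← Real.rpow_natCast (A+b^2), ← Real.rpow_add hAb]
      congr 1; push_cast; ring
  rw [e1]
  field_simp

lemma rad_cont {l A : ℝ} (hl : 0 < l) (hA : 0 < A) :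
    Continuous (fun b : ℝ => (1/(2*l*A)) * (b^2/(A+b^2))^l) := by
  apply continuous_const.mul
  apply Continuous.rpow_const
  · apply Continuous.div (by fun_prop) (by fun_prop)
    intro b; positivity
  · intro b; right; exact hl.le

lemma rad_lim {l A : ℝ} (hl : 0 < l) (hA : 0 < A) :
    Filter.Tendsto (fun b : ℝ => (1/(2*l*A)) * (b^2/(A+b^2))^l) Filter.atTop (nhds (1/(2*l*A))) := by
  have h1 : Filter.Tendsto (fun b : ℝ => 1 - A / (A+b^2)) Filter.atTop (nhds (1 - 0)) := by
    apply Filter.Tendsto.sub tendsto_const_nhds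
    apply Filter.Tendsto.const_div_atTop
    exact Filter.tendsto_atTop_add_const_left _ _ (Filter.tendsto_pow_atTop (by norm_num))
  have h2 : Filter.Tendsto (fun b : ℝ => b^2/(A+b^2)) Filter.atTop (nhds 1) := by
    rw [sub_zero] at h1
    refine h1.congr (fun b => ?_)
    have : A + b^2 ≠ 0 := by positivity
    field_simp
    ring
  have h3 := (h2.rpow_const (p := l) (Or.inr hl.le)).const_mul (1/(2*l*A))
  simpa using h3

lemma rad_int {l A : ℝ} (hl : 0 < l) (hA : 0 < A) :
    IntegrableOn (fun b : ℝ => b^(2*l-1) * (A + b^2)^(-(l+1))) (Ioi 0) := by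
  refine integrableOn_Ioi_deriv_of_nonneg (rad_cont hl hA).continuousWithinAt
    (fun b hb => rad_deriv hl hA hb) ?_ (rad_lim hl hA)
  intro b hb
  have hb : 0 < b := hb
  positivity

lemma rad_integral {l A : ℝ} (hl : 0 < l) (hA : 0 < A) :
    ∫ b in Ioi (0:ℝ), b^(2*l-1) * (A + b^2)^(-(l+1)) = 1/(2*l*A) := by
  rw [integral_Ioi_of_hasDerivAt_of_nonneg (rad_cont hl hA).continuousWithinAt
    (fun b hb => rad_deriv hl hA hb) ?_ (rad_lim hl hA)]
  · simp [Real.zero_rpow hl.ne']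
  intro b hb
  have hb : 0 < b := hb
  positivity

lemma cauchy_int {x t : ℝ} (ht : 0 < t) :
    Integrable (fun a : ℝ => 1/((x-a)^2+t^2)) ∧ ∫ a : ℝ, 1/((x-a)^2+t^2) = π/t := by
  have e : ∀ a : ℝ, 1/((x-a)^2+t^2) = t⁻¹^2 * (fun u : ℝ => (1+u^2)⁻¹) (t⁻¹ * (x - a)) := by
    intro a
    have : (x-a)^2+t^2 ≠ 0 := by positivity
    have h2 : 1 + (t⁻¹*(x-a))^2 ≠ 0 := by positivity
    simp only
    field_simp
    ring
  have h1 : Integrable (fun u : ℝ => (1+(t⁻¹*u)^2)⁻¹) :=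
    integrable_inv_one_add_sq.comp_mul_left' (inv_ne_zero ht.ne')
  constructor
  · simp_rw [e]
    exact (h1.comp_sub_left x).const_mul _
  · simp_rw [e]
    rw [integral_const_mul, integral_sub_left_eq_self (fun u : ℝ => (fun u : ℝ => (1+u^2)⁻¹) (t⁻¹ * u)) volume x,
      Measure.integral_comp_mul_left (fun u : ℝ => (1+u^2)⁻¹) t⁻¹, integral_univ_inv_one_add_sq]
    rw [inv_inv, abs_of_pos ht, smul_eq_mul]
    field_simp

noncomputable def Gf (l x t : ℝ) (q : ℝ × ℝ) : ℝ :=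
  q.2^(2*l-1) * ((x-q.1)^2 + t^2 + q.2^2)^(-(l+1))

lemma Gf_integral {l x t : ℝ} (hl : 0 < l) (ht : 0 < t) :
    ∫ q in (univ : Set ℝ) ×ˢ Ioi (0:ℝ), Gf l x t q = π/(2*l*t) := by
  have hA : ∀ a : ℝ, 0 < (x-a)^2 + t^2 := fun a => by positivity
  have hint : IntegrableOn (Gf l x t) ((univ : Set ℝ) ×ˢ Ioi (0:ℝ)) (volume.prod volume) := by
    unfold IntegrableOn
    rw [← Measure.prod_restrict]
    have hm : AEStronglyMeasurable (Gf l x t) ((volume.restrict univ).prod (volume.restrict (Ioi 0))) := by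
      rw [Measure.prod_restrict]
      apply ContinuousOn.aestronglyMeasurable _ (MeasurableSet.univ.prod measurableSet_Ioi)
      unfold Gf
      apply ContinuousOn.mul
      · apply ContinuousOn.rpow_const (by fun_prop)
        intro q hq; left; exact (show 0 < q.2 from hq.2).ne'
      · apply ContinuousOn.rpow_const (by fun_prop)
        intro q hq; left; have := hA q.1; positivity
    rw [integrable_prod_iff hm]
    constructor
    · exact Filter.Eventually.of_forall (fun a => rad_int hl (hA a))
    · have : (fun a => ∫ b in Ioi (0:ℝ), ‖Gf l x t (a,b)‖) = fun a => (1/(2*l)) * (1/((x-a)^2+t^2)) := by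
        funext a
        rw [one_div_mul_one_div, ← rad_integral hl (hA a)]
        apply setIntegral_congr_fun measurableSet_Ioi
        intro b hb
        have hb : 0 < b := hb
        simp only [Gf]
        rw [Real.norm_of_nonneg (by positivity)]
      rw [this, Measure.restrict_univ]
      exact (cauchy_int ht).1.const_mul _
  rw [Measure.volume_eq_prod, setIntegral_prod _ hint, Measure.restrict_univ]
  have : (fun a => ∫ b in Ioi (0:ℝ), Gf l x t (a,b)) = fun a => (1/(2*l)) * (1/((x-a)^2+t^2)) := by
    funext a
    rw [one_div_mul_one_div, ← rad_integral hl (hA a)]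
    rfl
  rw [this, integral_const_mul, (cauchy_int ht).2]
  field_simp

lemma mass {l x t : ℝ} (hl : 0 < l) (ht : 0 < t) :
    II l (fun y => y^l) (l+1) 0 (x,t) = π/(2*l*t) := by
  rw [← Gf_integral (x := x) hl ht]
  rw [← integral_indicator (MeasurableSet.univ.prod measurableSet_Ioi), ← integral_comp_polarCoord_symm]
  unfold II
  have hsub : ZZ ⊆ polarCoord.target := by
    intro z hz
    rw [polarCoord_target]
    exact ⟨hz.1, by linarith [hz.2.1, Real.pi_pos], hz.2.2⟩
  refine Eq.trans ?_ (setIntegral_eq_of_subset_of_forall_sdiff_eq_zero (s := ZZ) ?_ hsub ?_).symm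
  · apply setIntegral_congr_fun measZZ
    intro z hz
    have hy : 0 < z.1 := hz.1
    have hs : 0 < Real.sin z.2 := Real.sin_pos_of_pos_of_lt_pi hz.2.1 hz.2.2
    simp only
    rw [indicator_of_mem]
    · simp only [Phi, Gf, polarCoord_symm_apply, pow_zero, smul_eq_mul]
      have e : (x - z.1 * Real.cos z.2)^2 + t^2 + (z.1 * Real.sin z.2)^2 = DD x t z.1 z.2 := by
        unfold DD
        linear_combination z.1^2 * (Real.sin_sq_add_cos_sq z.2)
      rw [e, Real.mul_rpow hy.le hs.le]
      have e2 : z.1^l * z.1^l = z.1 * z.1^(2*l-1) := by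
        rw [← Real.rpow_add hy, mul_comm z.1, ← Real.rpow_add_one hy.ne']
        congr 1; ring
      rw [e2]
      ring
    · refine ⟨mem_univ _, ?_⟩
      simp only [polarCoord_symm_apply, mem_Ioi]
      positivity
  · rw [polarCoord_target]; exact measurableSet_Ioi.prod measurableSet_Ioo
  · intro z hz
    rw [indicator_of_notMem, smul_zero]
    rintro ⟨-, h⟩
    simp only [polarCoord_symm_apply, mem_Ioi] at h
    have hz1 := hz.1
    rw [polarCoord_target] at hz1
    have hy : 0 < z.1 := hz1.1
    have hs : 0 < Real.sin z.2 := by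
      by_contra hcon
      nlinarith
    apply hz.2
    refine ⟨hy, ?_, hz1.2.2⟩
    by_contra hcon
    have := Real.sin_nonpos_of_nonpos_of_neg_pi_le (not_lt.1 hcon) hz1.2.1.le
    linarith

lemma good_pow {l : ℝ} (hl : 0 < l) : GoodF l (fun y => y^l) := by
  have hc : ContinuousOn (fun y : ℝ => y^l) (Ioi (0:ℝ)) :=
    (Real.continuous_rpow_const hl.le).continuousOn
  refine ⟨hc, ?_⟩
  refine Integrable.mono' (integrable_inv_one_add_sq.integrableOn) ?_ ?_
  · apply ContinuousOn.aestronglyMeasurable _ measurableSet_Ioi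
    apply ContinuousOn.div (hc.mul hc.abs)
    · apply ContinuousOn.rpow_const (by fun_prop)
      intro y hy; left; positivity
    · intro y hy; positivity
  · refine (ae_restrict_iff' measurableSet_Ioi).2 (Filter.Eventually.of_forall ?_)
    intro y hy
    have hy : 0 < y := hy
    rw [Real.norm_of_nonneg (by positivity), abs_of_pos (by positivity), Real.rpow_add_one (by positivity),
      ← Real.mul_rpow hy.le hy.le, div_mul_eq_div_div, ← Real.div_rpow (by positivity) (by positivity), ← one_div]
    apply div_le_div_of_nonneg_right _ (by positivity)
    apply Real.rpow_le_one (by positivity) _ hl.le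
    rw [div_le_one (by positivity)]
    nlinarith

lemma good_sub {l : ℝ} (hl : 0 < l) {f : ℝ → ℝ} (hf : GoodF l f) (g : ℝ) :
    GoodF l (fun y => f y - g * y^l) := by
  have hp := good_pow hl
  have hc : ContinuousOn (fun y => f y - g * y^l) (Ioi (0:ℝ)) := hf.cont.sub (continuousOn_const.mul hp.cont)
  refine ⟨hc, ?_⟩
  refine Integrable.mono' (hf.int.add (hp.int.const_mul |g|)) ?_ ?_
  · apply ContinuousOn.aestronglyMeasurable _ measurableSet_Ioi
    apply ContinuousOn.div (hp.cont.mul hc.abs)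
    · apply ContinuousOn.rpow_const (by fun_prop)
      intro y hy; left; positivity
    · intro y hy; positivity
  · refine (ae_restrict_iff' measurableSet_Ioi).2 (Filter.Eventually.of_forall ?_)
    intro y hy
    have hy : 0 < y := hy
    rw [Real.norm_of_nonneg (by positivity)]
    simp only [Pi.add_apply]
    have h1 : |f y - g * y^l| ≤ |f y| + |g| * |y^l| := by
      rw [← abs_mul]; exact abs_sub _ _
    calc y^l * |f y - g * y^l| / (1+y^2)^(l+1) ≤ y^l * (|f y| + |g| * |y^l|) / (1+y^2)^(l+1) := by gcongr
      _ = _ := by ring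

lemma II_sub {l : ℝ} (hl : 0 < l) {f : ℝ → ℝ} (hf : GoodF l f) (g : ℝ) {x t : ℝ} (hx : 0 < x) (ht : 0 < t) :
    II l (fun y => f y - g * y^l) (l+1) 0 (x,t) = II l f (l+1) 0 (x,t) - g * (π/(2*l*t)) := by
  rw [← mass (x := x) hl ht]
  have i1 := Phi_int (k := 0) (p := (x,t)) (a := l+1) (by simp) hl hf hx ht
  have i2 := Phi_int (k := 0) (p := (x,t)) (a := l+1) (by simp) hl (good_pow hl) hx ht
  unfold II
  rw [← integral_const_mul, ← integral_sub i1 (i2.const_mul g)]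
  congr 1
  funext z
  unfold Phi
  ring

lemma II_near {l : ℝ} (hl : 0 < l) {h : ℝ → ℝ} (hh : GoodF l h) {x0 δ ε M : ℝ} (hδ : 0 < δ)
    (hnear : ∀ y, 0 < y → |y - x0| < δ → |h y| ≤ ε * y^l) (hε : 0 ≤ ε)
    {x t : ℝ} (hx : 0 < x) (hxM : x ≤ M) (hx0 : |x - x0| < δ/2) (ht : 0 < t) :
    |II l h (l+1) 0 (x,t)| ≤ ε * (π/(2*l*t)) +
      (2 + (1 + 2*M^2)/(δ/2)^2)^(l+1) * ∫ z in ZZ, Bnd l h z := by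
  have i1 := Phi_int (k := 0) (p := (x,t)) (a := l+1) (by simp) hl hh hx ht
  have i2 := Phi_int (k := 0) (p := (x,t)) (a := l+1) (by simp) hl (good_pow hl) hx ht
  have i3 := Bnd_int hl hh
  rw [← mass (x := x) hl ht, ← integral_const_mul]
  unfold II
  rw [← integral_const_mul, ← integral_add (i2.const_mul ε) (i3.const_mul _)]
  refine abs_integral_le_integral_abs.trans ?_
  refine setIntegral_mono_on i1.abs ((i2.const_mul ε).add (i3.const_mul _)) measZZ ?_
  intro z hz
  have hy : 0 < z.1 := hz.1
  have hs : 0 < Real.sin z.2 := Real.sin_pos_of_pos_of_lt_pi hz.2.1 hz.2.2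
  have hD := DD_pos (θ := z.2) hx ht hy
  have hB : 0 ≤ Bnd l h z := by unfold Bnd; positivity
  have hP : 0 ≤ Phi l (fun y => y^l) (l+1) 0 (x,t) z := by
    simp only [Phi, pow_zero]; positivity
  by_cases hc : |z.1 - x0| < δ
  · have h1 : |Phi l h (l+1) 0 (x,t) z| ≤ ε * Phi l (fun y => y^l) (l+1) 0 (x,t) z := by
      simp only [Phi, pow_zero, mul_one]
      rw [abs_mul, abs_mul, abs_mul, abs_of_pos (Real.rpow_pos_of_pos hy _),
        abs_of_pos (Real.rpow_pos_of_pos hs _), abs_of_pos (Real.rpow_pos_of_pos hD _)]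
      have := hnear z.1 hy hc
      calc _ ≤ z.1^l * (ε * z.1^l) * Real.sin z.2 ^ (2*l-1) * DD x t z.1 z.2 ^ (-(l+1)) := by gcongr
        _ = _ := by ring
    have h2 : 0 ≤ (2 + (1 + 2*M^2)/(δ/2)^2)^(l+1) * Bnd l h z := by positivity
    linarith
  · have hge := DD_ge (t := t) (θ := z.2) hx hy
    have hd : δ/2 ≤ |x - z.1| := by
      have := abs_sub_le z.1 x x0
      rw [abs_sub_comm z.1 x] at this
      linarith
    have hsq : (δ/2)^2 ≤ (x - z.1)^2 := by
      rw [← sq_abs (x - z.1)]; gcongr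
    have h1 := Phi_bound (l := l) (a := l+1) (k := 0) (by simp) hl (f := h) (p := (x,t)) (z := z)
      (K := 2 + (1 + 2*M^2)/(δ/2)^2) (by positivity) hz hD
      (key_lower (half_pos hδ) hx hxM (by simp only; nlinarith [sq_nonneg t]) (by simp only; nlinarith [sq_nonneg t]))
    have h2 : 0 ≤ ε * Phi l (fun y => y^l) (l+1) 0 (x,t) z := by positivity
    linarith

theorem statement8 (l : ℝ) (hl : 0 < l) (f : ℝ → ℝ)
    (hf : ContinuousOn f (Ioi (0:ℝ)))
    (hint : IntegrableOn (fun y => y ^ l * |f y| / (1 + y ^ 2) ^ (l + 1)) (Ioi (0:ℝ)))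
    (V : ℝ × ℝ → ℝ)
    (hV : ∀ x t : ℝ, V (x, t) =
      if 0 < t then ∫ y in Ioi (0:ℝ), besselPoissonKernel l x y t * f y else f x) :
    ContinuousOn V (Ioi (0:ℝ) ×ˢ Ici (0:ℝ)) ∧
    ContDiffOn ℝ 2 V (Ioi (0:ℝ) ×ˢ Ioi (0:ℝ)) ∧
    ∀ x t : ℝ, 0 < x → 0 < t →
      deriv (deriv (fun s => V (x, s))) t + deriv (deriv (fun z => V (z, t))) x
        - l * (l - 1) / x ^ 2 * V (x, t) = 0 := by
  have hg : GoodF l f := ⟨hf, hint⟩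
  have hV1 : ∀ x t : ℝ, 0 < x → 0 < t → V (x,t) = 2 * l / π * x ^ l * t * II l f (l+1) 0 (x,t) := by
    intro x t hx ht
    rw [hV, if_pos ht, V_formula hl hg hx ht]
  have hC2 : ContDiffOn ℝ 2 V (Ioi (0:ℝ) ×ˢ Ioi (0:ℝ)) := by
    have h1 := II_contDiff hl hg 2 (l+1) 0 (by simp)
    have h2 : ContDiffOn ℝ 2 (fun p : ℝ × ℝ => 2 * l / π * p.1 ^ l * p.2 * II l f (l+1) 0 p) QQ := by
      have f1 : ContDiffOn ℝ 2 (fun p : ℝ × ℝ => p.1) QQ := contDiff_fst.contDiffOn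
      have f2 : ContDiffOn ℝ 2 (fun p : ℝ × ℝ => p.2) QQ := contDiff_snd.contDiffOn
      exact ((contDiffOn_const.mul (f1.rpow_const_of_ne
        (fun p hp => (show 0 < p.1 from hp.1).ne'))).mul f2).mul h1
    exact h2.congr (fun p hp => hV1 p.1 p.2 hp.1 hp.2)
  refine ⟨?_, hC2, fun x t hx ht => pde hl hg hx ht V hV1⟩
  rintro ⟨x0, t0⟩ ⟨hx0, ht0⟩
  have hx0 : 0 < x0 := hx0
  rcases (show 0 ≤ t0 from ht0).lt_or_eq with ht0 | rfl
  · have : Ioi (0:ℝ) ×ˢ Ioi (0:ℝ) ∈ nhds (x0, t0) := QQ_open.mem_nhds ⟨hx0, ht0⟩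
    exact (hC2.continuousOn.continuousAt this).continuousWithinAt
  have hVx0 : V (x0, 0) = f x0 := by rw [hV]; simp
  have hfc : ContinuousAt f x0 := hf.continuousAt (Ioi_mem_nhds hx0)
  have hxl : 0 < x0^l := by positivity
  set g := f x0 / x0^l with hgdef
  have hgx : x0^l * g = f x0 := by rw [hgdef]; field_simp
  set h : ℝ → ℝ := fun y => f y - g * y^l with hh
  have hgood : GoodF l h := good_sub hl hg g
  unfold ContinuousWithinAt
  rw [hVx0, Metric.tendsto_nhds]
  intro η hη
  -- choose the closeness parameter
  set ε := η / (2 * x0^l) with hεdef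
  have hε : 0 < ε := by positivity
  have hnear : ∃ δ > 0, ∀ y, 0 < y → |y - x0| < δ → |h y| ≤ ε * y^l := by
    have hpc : ContinuousAt (fun y : ℝ => y^l) x0 := (Real.continuous_rpow_const hl.le).continuousAt
    have hc1 : ContinuousAt (fun y => |h y| - ε * y^l) x0 :=
      ((hfc.sub (continuousAt_const.mul hpc)).abs).sub (continuousAt_const.mul hpc)
    have hneg : |h x0| - ε * x0^l < 0 := by
      have : h x0 = 0 := by simp only [hh]; rw [← hgx]; ring
      rw [this, abs_zero]
      have : 0 < ε * x0^l := by positivity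
      linarith
    obtain ⟨δ, hδ, H⟩ := Metric.eventually_nhds_iff.1 (hc1.eventually_lt continuousAt_const hneg)
    refine ⟨δ, hδ, fun y _ hy => ?_⟩
    have := H (y := y) (by rw [Real.dist_eq]; exact hy)
    linarith
  obtain ⟨δ, hδ, hnear⟩ := hnear
  set M := x0 + δ with hM
  set C := (2 + (1 + 2*M^2)/(δ/2)^2)^(l+1) * ∫ z in ZZ, Bnd l h z with hC
  have hlim : Filter.Tendsto (fun p : ℝ × ℝ => ε * p.1^l + 2 * l / π * p.1^l * p.2 * C + |p.1^l * g - f x0|)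
      (nhds (x0, 0)) (nhds (ε * x0^l + 2 * l / π * x0^l * 0 * C + |x0^l * g - f x0|)) := by
    have : Continuous (fun p : ℝ × ℝ => ε * p.1^l + 2 * l / π * p.1^l * p.2 * C + |p.1^l * g - f x0|) := by
      have hp : Continuous (fun p : ℝ × ℝ => p.1^l) := (Real.continuous_rpow_const hl.le).comp continuous_fst
      fun_prop
    exact this.tendsto (x0, 0)
  have hlt : ε * x0^l + 2 * l / π * x0^l * 0 * C + |x0^l * g - f x0| < η := by
    rw [hgx, sub_self, abs_zero, hεdef]
    have : η / (2 * x0^l) * x0^l = η/2 := by field_simp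
    rw [this]; linarith
  have E1 := hlim.eventually_lt_const hlt
  have E2 : ∀ᶠ p : ℝ × ℝ in nhds (x0, 0), |p.1 - x0| < δ/2 := by
    have : Continuous (fun p : ℝ × ℝ => |p.1 - x0|) := by fun_prop
    exact (this.tendsto (x0,0)).eventually_lt_const (by simp [hδ])
  have E3 : ∀ᶠ p : ℝ × ℝ in nhds (x0, 0), dist (f p.1) (f x0) < η := by
    have : Filter.Tendsto (fun p : ℝ × ℝ => f p.1) (nhds (x0,(0:ℝ))) (nhds (f x0)) :=
      hfc.tendsto.comp (continuous_fst.tendsto (x0,(0:ℝ)))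
    exact (Metric.tendsto_nhds.1 this) η hη
  filter_upwards [nhdsWithin_le_nhds E1, nhdsWithin_le_nhds E2, nhdsWithin_le_nhds E3,
    self_mem_nhdsWithin] with p e1 e2 e3 e4
  obtain ⟨x, t⟩ := p
  have hx : 0 < x := e4.1
  simp only at e1 e2 e3
  rcases (show 0 ≤ t from e4.2).lt_or_eq with ht | ht
  · rw [Real.dist_eq]
    have hxM : x ≤ M := by have := (abs_lt.1 e2).2; rw [hM]; linarith
    have hb := II_near hl hgood hδ hnear hε.le hx hxM e2 ht
    rw [← hC] at hb
    have hs := II_sub hl hg g hx ht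
    have hpi := Real.pi_pos
    have e : V (x,t) = x^l * g + 2 * l / π * x^l * t * II l h (l+1) 0 (x,t) := by
      rw [hV1 x t hx ht, hh, hs]
      field_simp
      ring
    have e' : V (x,t) - f x0 = 2 * l / π * x^l * t * II l h (l+1) 0 (x,t) + (x^l * g - f x0) := by
      rw [e]; ring
    rw [e']
    refine (abs_add_le _ _).trans_lt (lt_of_le_of_lt ?_ e1)
    gcongr
    rw [abs_mul, abs_of_pos (show 0 < 2 * l / π * x^l * t by positivity)]
    calc _ ≤ 2 * l / π * x^l * t * (ε * (π/(2*l*t)) + C) := by gcongr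
      _ = _ := by field_simp
  · rw [← ht, hV]
    simpa using e3
end

section
/- For λ > 0 and every x, t ∈ (0,∞), the function y ↦ P_t^λ(x,y) belongs to the Bessel Hardy space H¹_o(ℝ): sup_{s>0} |P_s^λ[P_t^λ(x,·)]| ∈ L¹(0,∞). Moreover ∫₀^∞ sup_{s>0} |P_s^λ[P_t^λ(x,·)](z)| dz ≤ C((x/t)^{2λ+1} + (x/t)^λ). -/
open MeasureTheory Real Set

lemma bp_half_bound (l A K : ℝ) (hl : 0 < l) (hA : 0 < A) (hK : 0 ≤ K) :
    IntervalIntegrable (fun θ => Real.sin θ ^ (2 * l - 1) /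
      (A + K * (1 - Real.cos θ)) ^ (l + 1)) volume 0 (π / 2) ∧
    ∫ θ in (0:ℝ)..(π / 2), Real.sin θ ^ (2 * l - 1) /
      (A + K * (1 - Real.cos θ)) ^ (l + 1) ≤ 2 ^ l / (l * A) * ((A + K) ^ l)⁻¹ := by
  have hpi : (0:ℝ) ≤ π / 2 := by positivity
  have hD : ∀ θ : ℝ, 0 < A + K * (1 - Real.cos θ) := fun θ => by
    have := Real.cos_le_one θ
    have := mul_nonneg hK (sub_nonneg.2 this)
    linarith
  set G : ℝ → ℝ := fun θ => ((1 - Real.cos θ) / (A + K * (1 - Real.cos θ))) ^ l with hG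
  set g : ℝ → ℝ := fun θ => l * A * (Real.sin θ * (1 - Real.cos θ) ^ (l - 1) /
      (A + K * (1 - Real.cos θ)) ^ (l + 1)) with hg
  have hGc : Continuous G := by
    refine Continuous.rpow_const ?_ (fun _ => Or.inr hl.le)
    exact Continuous.div (by fun_prop) (by fun_prop) (fun θ => (hD θ).ne')
  have hw : ∀ θ ∈ Ioo 0 (π / 2), 0 < 1 - Real.cos θ := by
    intro θ hθ
    have h1 : Real.cos θ < Real.cos 0 :=
      Real.cos_lt_cos_of_nonneg_of_le_pi_div_two le_rfl hθ.2.le hθ.1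
    rw [Real.cos_zero] at h1
    linarith
  have hs : ∀ θ ∈ Ioo 0 (π / 2), 0 < Real.sin θ := fun θ hθ =>
    Real.sin_pos_of_pos_of_lt_pi hθ.1 (by linarith [hθ.2, Real.pi_pos])
  have hc : ∀ θ ∈ Ioo 0 (π / 2), 0 < Real.cos θ := fun θ hθ =>
    Real.cos_pos_of_mem_Ioo ⟨by linarith [hθ.1], hθ.2⟩
  have hder : ∀ θ ∈ Ioo 0 (π / 2), HasDerivAt G (g θ) θ := by
    intro θ hθ
    have h0 : HasDerivAt (fun θ => 1 - Real.cos θ) (Real.sin θ) θ := by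
      simpa using (Real.hasDerivAt_cos θ).const_sub 1
    have h1 := ((h0.div ((h0.const_mul K).const_add A) (hD θ).ne').rpow_const
      (p := l) (Or.inl (div_pos (hw θ hθ) (hD θ)).ne'))
    refine h1.congr_deriv ?_
    have hw' := hw θ hθ
    have hD' := hD θ
    simp only [hg, Pi.div_apply]
    set w := 1 - Real.cos θ
    rw [Real.div_rpow hw'.le hD'.le, show l + 1 = (l - 1) + 2 by ring,
      Real.rpow_add hD', Real.rpow_two]
    have := Real.rpow_pos_of_pos hD' (l - 1)
    field_simp
    ring
  have hgpos : ∀ θ ∈ Ioo 0 (π / 2), 0 ≤ g θ := by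
    intro θ hθ
    have := hw θ hθ
    have := hs θ hθ
    have := hD θ
    simp only [hg]
    positivity
  have hgi : IntervalIntegrable g volume 0 (π / 2) := by
    rw [intervalIntegrable_iff_integrableOn_Ioc_of_le hpi]
    exact intervalIntegral.integrableOn_deriv_of_nonneg hGc.continuousOn hder hgpos
  have hgv : ∫ θ in (0:ℝ)..(π / 2), g θ = ((A + K) ^ l)⁻¹ := by
    rw [intervalIntegral.integral_eq_sub_of_hasDerivAt_of_le hpi hGc.continuousOn hder hgi]
    simp only [hG, Real.cos_pi_div_two, Real.cos_zero]
    simp [Real.zero_rpow hl.ne', Real.inv_rpow (by linarith : 0 ≤ A + K)]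
  have hle : ∀ θ ∈ Ioo 0 (π / 2), Real.sin θ ^ (2 * l - 1) /
      (A + K * (1 - Real.cos θ)) ^ (l + 1) ≤ 2 ^ l / (l * A) * g θ := by
    intro θ hθ
    have hw' := hw θ hθ
    have hs' := hs θ hθ
    have hc' := hc θ hθ
    have hD' := Real.rpow_pos_of_pos (hD θ) (l + 1)
    have e : Real.sin θ ^ (2 * l - 1) =
        Real.sin θ * ((1 - Real.cos θ) ^ (l - 1) * (1 + Real.cos θ) ^ (l - 1)) := by
      rw [← Real.mul_rpow hw'.le (by linarith),
        show (1 - Real.cos θ) * (1 + Real.cos θ) = Real.sin θ ^ (2:ℝ) by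
          rw [Real.rpow_two]; nlinarith [Real.sin_sq_add_cos_sq θ],
        ← Real.rpow_mul hs'.le]
      nth_rewrite 2 [← Real.rpow_one (Real.sin θ)]
      rw [← Real.rpow_add hs']
      congr 1; ring
    have h2 : (1 + Real.cos θ) ^ (l - 1) ≤ 2 ^ l := by
      calc (1 + Real.cos θ) ^ (l - 1) ≤ (1 + Real.cos θ) ^ l :=
            Real.rpow_le_rpow_of_exponent_le (by linarith) (by linarith)
        _ ≤ 2 ^ l := Real.rpow_le_rpow (by linarith) (by linarith [Real.cos_le_one θ]) hl.le
    have e2 : 2 ^ l / (l * A) * g θ = Real.sin θ * ((1 - Real.cos θ) ^ (l - 1) * 2 ^ l) /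
        (A + K * (1 - Real.cos θ)) ^ (l + 1) := by
      simp only [hg]
      field_simp
    rw [e2, e]
    gcongr
  have hfm : Measurable (fun θ => Real.sin θ ^ (2 * l - 1) /
      (A + K * (1 - Real.cos θ)) ^ (l + 1)) := by fun_prop
  have hfi : IntervalIntegrable (fun θ => Real.sin θ ^ (2 * l - 1) /
      (A + K * (1 - Real.cos θ)) ^ (l + 1)) volume 0 (π / 2) := by
    rw [intervalIntegrable_iff_integrableOn_Ioo_of_le hpi] at hgi ⊢
    refine Integrable.mono' (hgi.const_mul (2 ^ l / (l * A))) hfm.aestronglyMeasurable ?_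
    refine (ae_restrict_iff' measurableSet_Ioo).2 (Filter.Eventually.of_forall fun θ hθ => ?_)
    have := hs θ hθ
    have := hD θ
    rw [Real.norm_of_nonneg (by positivity)]
    exact hle θ hθ
  refine ⟨hfi, ?_⟩
  rw [← hgv, ← intervalIntegral.integral_const_mul]
  exact intervalIntegral.integral_mono_on_of_le_Ioo hpi hfi (hgi.const_mul _) hle

lemma bp_bound (l A K : ℝ) (hl : 0 < l) (hA : 0 < A) (hK : 0 ≤ K) :
    IntervalIntegrable (fun θ => Real.sin θ ^ (2 * l - 1) /
      (A + K * (1 - Real.cos θ)) ^ (l + 1)) volume 0 π ∧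
    ∫ θ in (0:ℝ)..π, Real.sin θ ^ (2 * l - 1) /
      (A + K * (1 - Real.cos θ)) ^ (l + 1) ≤ 2 * (2 ^ l / (l * A) * ((A + K) ^ l)⁻¹) := by
  obtain ⟨h1, h2⟩ := bp_half_bound l A K hl hA hK
  have hpi : (0:ℝ) ≤ π / 2 := by positivity
  set f : ℝ → ℝ := fun θ => Real.sin θ ^ (2 * l - 1) /
      (A + K * (1 - Real.cos θ)) ^ (l + 1) with hf
  have hfm : Measurable f := by fun_prop
  have hle : ∀ θ ∈ Ioo 0 (π / 2), f (π - θ) ≤ f θ := by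
    intro θ hθ
    have hs : 0 < Real.sin θ :=
      Real.sin_pos_of_pos_of_lt_pi hθ.1 (by linarith [hθ.2, Real.pi_pos])
    have hc : 0 < Real.cos θ := Real.cos_pos_of_mem_Ioo ⟨by linarith [hθ.1], hθ.2⟩
    have hD : 0 < A + K * (1 - Real.cos θ) := by
      have := Real.cos_le_one θ
      have := mul_nonneg hK (sub_nonneg.2 this)
      linarith
    simp only [hf, Real.sin_pi_sub, Real.cos_pi_sub]
    gcongr
    linarith
  have hnn : ∀ θ ∈ Ioo 0 (π / 2), 0 ≤ f (π - θ) := by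
    intro θ hθ
    have hs : 0 < Real.sin θ :=
      Real.sin_pos_of_pos_of_lt_pi hθ.1 (by linarith [hθ.2, Real.pi_pos])
    have hc : 0 < Real.cos θ := Real.cos_pos_of_mem_Ioo ⟨by linarith [hθ.1], hθ.2⟩
    have : 0 ≤ K * (1 - -Real.cos θ) := mul_nonneg hK (by linarith)
    simp only [hf, Real.sin_pi_sub, Real.cos_pi_sub]
    positivity
  have hi : IntervalIntegrable (fun θ => f (π - θ)) volume 0 (π / 2) := by
    have h1' := h1
    rw [intervalIntegrable_iff_integrableOn_Ioo_of_le hpi] at h1' ⊢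
    refine Integrable.mono' h1'
      (hfm.comp (measurable_const.sub measurable_id)).aestronglyMeasurable ?_
    refine (ae_restrict_iff' measurableSet_Ioo).2 (Filter.Eventually.of_forall fun θ hθ => ?_)
    rw [Real.norm_of_nonneg (hnn θ hθ)]
    exact hle θ hθ
  have hi2 : IntervalIntegrable f volume (π / 2) π := by
    have := hi.comp_sub_left π
    simp only [sub_sub_cancel, sub_zero] at this
    rw [show π - π / 2 = π / 2 by ring] at this
    exact this.symm
  have hv : ∫ θ in (π / 2)..π, f θ = ∫ θ in (0:ℝ)..(π / 2), f (π - θ) := by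
    rw [intervalIntegral.integral_comp_sub_left f π]
    congr 1 <;> ring
  refine ⟨h1.trans hi2, ?_⟩
  rw [← intervalIntegral.integral_add_adjacent_intervals h1 hi2, hv]
  have := intervalIntegral.integral_mono_on_of_le_Ioo hpi hi h1 hle
  linarith

lemma bp_sin_int (l : ℝ) (hl : 0 < l) :
    IntervalIntegrable (fun θ => Real.sin θ ^ (2 * l - 1)) volume 0 π := by
  simpa using (bp_bound l 1 0 hl one_pos le_rfl).1

/-- The majorant of the (normalised) kernel. -/
noncomputable def bpq (l x y t : ℝ) : ℝ :=
  t / (((x - y) ^ 2 + t ^ 2) * ((x - y) ^ 2 + t ^ 2 + 2 * x * y) ^ l)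

noncomputable def bpC (l : ℝ) : ℝ := 2 * l / π * (2 * (2 ^ l / l))

lemma bpC_pos (l : ℝ) (hl : 0 < l) : 0 < bpC l := by
  unfold bpC; positivity

lemma bp_kernel_nonneg (l x y t : ℝ) (hl : 0 < l) (hx : 0 ≤ x) (hy : 0 ≤ y) (ht : 0 < t) :
    0 ≤ besselPoissonKernel l x y t := by
  unfold besselPoissonKernel
  refine mul_nonneg (by positivity) ?_
  refine intervalIntegral.integral_nonneg Real.pi_pos.le fun θ hθ => ?_
  have h1 := Real.sin_nonneg_of_mem_Icc hθ
  have h2 : 0 ≤ 1 - Real.cos θ := sub_nonneg.2 (Real.cos_le_one θ)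
  positivity

lemma bp_kernel_le (l x y t : ℝ) (hl : 0 < l) (hx : 0 ≤ x) (hy : 0 ≤ y) (ht : 0 < t) :
    besselPoissonKernel l x y t ≤ bpC l * (x * y) ^ l * bpq l x y t := by
  have hA : 0 < (x - y) ^ 2 + t ^ 2 := by positivity
  have h := (bp_bound l ((x - y) ^ 2 + t ^ 2) (2 * x * y) hl hA (by positivity)).2
  unfold besselPoissonKernel
  calc _ ≤ 2 * l * (x * y) ^ l * t / π * (2 * (2 ^ l / (l * ((x - y) ^ 2 + t ^ 2)) *
        (((x - y) ^ 2 + t ^ 2 + 2 * x * y) ^ l)⁻¹)) :=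
        mul_le_mul_of_nonneg_left h (by positivity)
    _ = _ := by
        unfold bpC bpq
        have : 0 < ((x - y) ^ 2 + t ^ 2 + 2 * x * y) ^ l := by positivity
        field_simp

lemma bpq_nonneg (l x y t : ℝ) (hx : 0 ≤ x) (hy : 0 ≤ y) (ht : 0 < t) :
    0 ≤ bpq l x y t := by
  unfold bpq; positivity

lemma bpq_le (l x y t : ℝ) (hl : 0 < l) (hx : 0 ≤ x) (hy : 0 ≤ y) (ht : 0 < t) :
    bpq l x y t ≤ (((x - y) ^ 2 + t ^ 2)⁻¹) ^ (l + 1 / 2) := by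
  have hA : 0 < (x - y) ^ 2 + t ^ 2 := by positivity
  unfold bpq
  set A := (x - y) ^ 2 + t ^ 2 with hAd
  have h1 : t ≤ A ^ (1 / 2 : ℝ) := by
    rw [← Real.sqrt_eq_rpow]
    exact Real.le_sqrt_of_sq_le (by nlinarith [sq_nonneg (x - y)])
  have h2 : A ^ l ≤ (A + 2 * x * y) ^ l :=
    Real.rpow_le_rpow hA.le (by nlinarith [mul_nonneg hx hy]) hl.le
  have h3 : (0:ℝ) < A ^ l := by positivity
  calc t / (A * (A + 2 * x * y) ^ l) ≤ A ^ (1 / 2 : ℝ) / (A * A ^ l) := by gcongr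
    _ = _ := by
      rw [Real.inv_rpow hA.le, Real.rpow_add hA]
      have h4 : A ^ (1 / 2 : ℝ) * A ^ (1 / 2 : ℝ) = A := by
        rw [← Real.rpow_add hA]; norm_num
      have h5 : (0:ℝ) < A ^ (1 / 2 : ℝ) := by positivity
      rw [eq_comm, eq_div_iff (by positivity), inv_mul_eq_div, div_eq_iff (by positivity)]
      linear_combination (-A ^ l) * h4

lemma bpq_le' (l x y t : ℝ) (hl : 0 < l) (hx : 0 ≤ x) (hy : 0 ≤ y) (ht : 0 < t) :
    (y ^ 2) ^ l * bpq l x y t ≤ t / ((x - y) ^ 2 + t ^ 2) := by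
  have hA : 0 < (x - y) ^ 2 + t ^ 2 := by positivity
  have hB : 0 < (x - y) ^ 2 + t ^ 2 + 2 * x * y := by positivity
  have h : (y ^ 2) ^ l ≤ ((x - y) ^ 2 + t ^ 2 + 2 * x * y) ^ l :=
    Real.rpow_le_rpow (by positivity) (by nlinarith [sq_nonneg x, sq_nonneg t]) hl.le
  unfold bpq
  have hB' := Real.rpow_pos_of_pos hB l
  rw [mul_div_assoc', div_le_div_iff₀ (by positivity) hA]
  calc _ ≤ ((x - y) ^ 2 + t ^ 2 + 2 * x * y) ^ l * t * ((x - y) ^ 2 + t ^ 2) := by gcongr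
    _ = _ := by ring

lemma bp_prod_le (l x y z s t : ℝ) (hl : 0 < l) (hx : 0 ≤ x) (hy : 0 ≤ y) (hz : 0 ≤ z)
    (hs : 0 < s) (ht : 0 < t) :
    besselPoissonKernel l z y s * besselPoissonKernel l x y t ≤
      bpC l ^ 2 * (x * z) ^ l * (8 / (t ^ 2 + (x - z) ^ 2)) ^ (l + 1 / 2) *
        (s / ((z - y) ^ 2 + s ^ 2) + t / ((x - y) ^ 2 + t ^ 2)) := by
  have hC := bpC_pos l hl
  have k1 := bp_kernel_le l z y s hl hz hy hs
  have k2 := bp_kernel_le l x y t hl hx hy ht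
  have n1 := bp_kernel_nonneg l z y s hl hz hy hs
  have n2 := bp_kernel_nonneg l x y t hl hx hy ht
  have q1 := bpq_nonneg l z y s hz hy hs
  have q2 := bpq_nonneg l x y t hx hy ht
  have a1 := bpq_le l z y s hl hz hy hs
  have a2 := bpq_le l x y t hl hx hy ht
  have b1 := bpq_le' l z y s hl hz hy hs
  have b2 := bpq_le' l x y t hl hx hy ht
  set R := (8 / (t ^ 2 + (x - z) ^ 2)) ^ (l + 1 / 2) with hR
  have hR0 : 0 ≤ R := by positivity
  have hY : 0 ≤ (y ^ 2) ^ l := by positivity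
  have key : (y ^ 2) ^ l * bpq l z y s * bpq l x y t ≤
      R * (s / ((z - y) ^ 2 + s ^ 2) + t / ((x - y) ^ 2 + t ^ 2)) := by
    have p1 : 0 ≤ s / ((z - y) ^ 2 + s ^ 2) := by positivity
    have p2 : 0 ≤ t / ((x - y) ^ 2 + t ^ 2) := by positivity
    have hE : 0 < t ^ 2 + (x - z) ^ 2 := by positivity
    rcases le_or_gt ((t ^ 2 + (x - z) ^ 2) / 8) ((x - y) ^ 2 + t ^ 2) with h | h
    · have : bpq l x y t ≤ R := a2.trans (by
        refine Real.rpow_le_rpow (by positivity) ?_ (by positivity)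
        rw [inv_eq_one_div, div_le_div_iff₀ (by positivity) hE]
        linarith)
      calc _ ≤ (s / ((z - y) ^ 2 + s ^ 2)) * R := by gcongr
        _ ≤ _ := by nlinarith
    · have : bpq l z y s ≤ R := a1.trans (by
        refine Real.rpow_le_rpow (by positivity) ?_ (by positivity)
        rw [inv_eq_one_div, div_le_div_iff₀ (by positivity) hE]
        nlinarith [sq_nonneg ((x - y) - (y - z)), sq_nonneg ((x - y) + (y - z)), sq_nonneg s,
          sq_nonneg t, sq_nonneg (x - y)])
      calc (y ^ 2) ^ l * bpq l z y s * bpq l x y t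
          = bpq l z y s * ((y ^ 2) ^ l * bpq l x y t) := by ring
        _ ≤ R * (t / ((x - y) ^ 2 + t ^ 2)) := by gcongr
        _ ≤ _ := by nlinarith
  have e : (z * y) ^ l * (x * y) ^ l = (x * z) ^ l * (y ^ 2) ^ l := by
    rw [← Real.mul_rpow (by positivity) (by positivity),
      ← Real.mul_rpow (by positivity) (by positivity)]
    congr 1; ring
  calc _ ≤ (bpC l * (z * y) ^ l * bpq l z y s) * (bpC l * (x * y) ^ l * bpq l x y t) := by
        gcongr
    _ = bpC l ^ 2 * ((z * y) ^ l * (x * y) ^ l) * (bpq l z y s * bpq l x y t) := by ring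
    _ = bpC l ^ 2 * (x * z) ^ l * ((y ^ 2) ^ l * bpq l z y s * bpq l x y t) := by rw [e]; ring
    _ ≤ bpC l ^ 2 * (x * z) ^ l *
        (R * (s / ((z - y) ^ 2 + s ^ 2) + t / ((x - y) ^ 2 + t ^ 2))) := by gcongr
    _ = _ := by ring

lemma bp_lorentz (z s : ℝ) (hs : 0 < s) :
    Integrable (fun y => s / ((z - y) ^ 2 + s ^ 2)) ∧
    ∫ y, s / ((z - y) ^ 2 + s ^ 2) = π := by
  have e : (fun y => s / ((z - y) ^ 2 + s ^ 2)) =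
      fun y => s⁻¹ * (fun u => (1 + (u / s) ^ 2)⁻¹) (z - y) := by
    funext y
    field_simp
    ring
  have i1 : Integrable (fun u => (1 + (u / s) ^ 2)⁻¹) :=
    integrable_inv_one_add_sq.comp_div hs.ne'
  rw [e]
  refine ⟨(i1.comp_sub_left z).const_mul _, ?_⟩
  rw [integral_const_mul, integral_sub_left_eq_self (fun u => (1 + (u / s) ^ 2)⁻¹) volume z,
    Measure.integral_comp_div (fun u => (1 + u ^ 2)⁻¹) s, integral_univ_inv_one_add_sq,
    abs_of_pos hs, smul_eq_mul]
  field_simp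

lemma bp_conv_le (l x z s t : ℝ) (hl : 0 < l) (hx : 0 ≤ x) (hz : 0 ≤ z)
    (hs : 0 < s) (ht : 0 < t) :
    |∫ y in Ioi (0:ℝ), besselPoissonKernel l z y s * besselPoissonKernel l x y t| ≤
      bpC l ^ 2 * (x * z) ^ l * (8 / (t ^ 2 + (x - z) ^ 2)) ^ (l + 1 / 2) * (2 * π) := by
  obtain ⟨i1, v1⟩ := bp_lorentz z s hs
  obtain ⟨i2, v2⟩ := bp_lorentz x t ht
  have hnn : ∀ y ∈ Ioi (0:ℝ), 0 ≤ besselPoissonKernel l z y s * besselPoissonKernel l x y t :=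
    fun y hy => mul_nonneg (bp_kernel_nonneg l z y s hl hz (le_of_lt hy) hs)
      (bp_kernel_nonneg l x y t hl hx (le_of_lt hy) ht)
  rw [abs_of_nonneg (setIntegral_nonneg measurableSet_Ioi hnn)]
  have hi : Integrable (fun y => bpC l ^ 2 * (x * z) ^ l *
      (8 / (t ^ 2 + (x - z) ^ 2)) ^ (l + 1 / 2) *
        (s / ((z - y) ^ 2 + s ^ 2) + t / ((x - y) ^ 2 + t ^ 2))) := (i1.add i2).const_mul _
  have hC := bpC_pos l hl
  calc _ ≤ ∫ y in Ioi (0:ℝ), bpC l ^ 2 * (x * z) ^ l *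
      (8 / (t ^ 2 + (x - z) ^ 2)) ^ (l + 1 / 2) *
        (s / ((z - y) ^ 2 + s ^ 2) + t / ((x - y) ^ 2 + t ^ 2)) := by
        refine integral_mono_of_nonneg ?_ hi.integrableOn ?_
        · exact (ae_restrict_iff' measurableSet_Ioi).2 (Filter.Eventually.of_forall hnn)
        · exact (ae_restrict_iff' measurableSet_Ioi).2 (Filter.Eventually.of_forall fun y hy =>
            bp_prod_le l x y z s t hl hx (le_of_lt hy) hz hs ht)
    _ ≤ ∫ y, bpC l ^ 2 * (x * z) ^ l *
      (8 / (t ^ 2 + (x - z) ^ 2)) ^ (l + 1 / 2) *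
        (s / ((z - y) ^ 2 + s ^ 2) + t / ((x - y) ^ 2 + t ^ 2)) := by
        refine setIntegral_le_integral hi (Filter.Eventually.of_forall fun y => ?_)
        have := hl
        simp only [Pi.zero_apply]
        positivity
    _ = _ := by
        rw [integral_const_mul, integral_add i1 i2, v1, v2]
        ring

lemma bp_den_ge (x y t θ : ℝ) :
    t ^ 2 ≤ (x - y) ^ 2 + t ^ 2 + 2 * x * y * (1 - Real.cos θ) := by
  have h : (x - y) ^ 2 + 2 * x * y * (1 - Real.cos θ) =
      (x - y * Real.cos θ) ^ 2 + (y * Real.sin θ) ^ 2 := by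
    linear_combination (-y ^ 2) * Real.sin_sq_add_cos_sq θ
  nlinarith [sq_nonneg (x - y * Real.cos θ), sq_nonneg (y * Real.sin θ)]

lemma bp_integrand_bound (l x y t : ℝ) (hl : 0 < l) (ht : 0 < t) (θ : ℝ) (hθ : θ ∈ Set.uIoc 0 π) :
    ‖Real.sin θ ^ (2 * l - 1) /
      ((x - y) ^ 2 + t ^ 2 + 2 * x * y * (1 - Real.cos θ)) ^ (l + 1)‖ ≤
    Real.sin θ ^ (2 * l - 1) / (t ^ 2) ^ (l + 1) := by
  rw [uIoc_of_le Real.pi_pos.le] at hθ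
  have hs : 0 ≤ Real.sin θ := Real.sin_nonneg_of_mem_Icc ⟨hθ.1.le, hθ.2⟩
  have hd := bp_den_ge x y t θ
  have h0 : 0 < t ^ 2 := by positivity
  have h1 := h0.trans_le hd
  rw [Real.norm_of_nonneg (by positivity)]
  gcongr

lemma bp_kernel_cont (l t : ℝ) (hl : 0 < l) (ht : 0 < t) :
    Continuous (fun p : ℝ × ℝ => besselPoissonKernel l p.1 p.2 t) := by
  unfold besselPoissonKernel
  refine Continuous.mul ?_ ?_
  · have : Continuous (fun p : ℝ × ℝ => (p.1 * p.2) ^ l) :=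
      (continuous_fst.mul continuous_snd).rpow_const (fun _ => Or.inr hl.le)
    fun_prop
  · refine intervalIntegral.continuous_of_dominated_interval
      (bound := fun θ => Real.sin θ ^ (2 * l - 1) / (t ^ 2) ^ (l + 1)) ?_ ?_ ?_ ?_
    · intro p
      exact Measurable.aestronglyMeasurable (by fun_prop)
    · intro p
      exact Filter.Eventually.of_forall fun θ hθ => bp_integrand_bound l p.1 p.2 t hl ht θ hθ
    · exact (bp_sin_int l hl).div_const _
    · refine Filter.Eventually.of_forall fun θ _ => ?_
      have hp : ∀ p : ℝ × ℝ,
          0 < (p.1 - p.2) ^ 2 + t ^ 2 + 2 * p.1 * p.2 * (1 - Real.cos θ) := fun p =>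
        lt_of_lt_of_le (by positivity) (bp_den_ge p.1 p.2 t θ)
      refine Continuous.div continuous_const ?_ (fun p => (Real.rpow_pos_of_pos (hp p) _).ne')
      exact Continuous.rpow_const (by fun_prop) (fun _ => Or.inr (by linarith))

lemma bp_conv_cont (l x s t : ℝ) (hl : 0 < l) (hx : 0 ≤ x) (hs : 0 < s) (ht : 0 < t) :
    Continuous (fun z : ℝ => ∫ y in Ioi (0:ℝ),
      besselPoissonKernel l |z| y s * besselPoissonKernel l x y t) := by
  have hC := bpC_pos l hl
  rw [continuous_iff_continuousAt]
  intro z0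
  have c1 := bp_kernel_cont l s hl hs
  have c2 := bp_kernel_cont l t hl ht
  set M := |z0| + 1
  have hM : 0 ≤ M := by positivity
  refine continuousAt_of_dominated (bound := fun y => bpC l ^ 2 * (x * M) ^ l *
    ((s ^ 2)⁻¹) ^ (l + 1 / 2) * (t / ((x - y) ^ 2 + t ^ 2))) ?_ ?_ ?_ ?_
  · refine Filter.Eventually.of_forall fun z => ?_
    refine Continuous.aestronglyMeasurable ?_
    exact (c1.comp (continuous_const.prodMk continuous_id)).mul
      (c2.comp (continuous_const.prodMk continuous_id))
  · have : ∀ᶠ z in nhds z0, |z| < M :=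
      continuous_abs.continuousAt.eventually_lt continuousAt_const (by simp [M])
    filter_upwards [this] with z hz
    refine (ae_restrict_iff' measurableSet_Ioi).2 (Filter.Eventually.of_forall fun y hy => ?_)
    have hy' : 0 ≤ y := le_of_lt hy
    have hz0 := abs_nonneg z
    have n1 := bp_kernel_nonneg l |z| y s hl hz0 hy' hs
    have n2 := bp_kernel_nonneg l x y t hl hx hy' ht
    have k1 := bp_kernel_le l |z| y s hl hz0 hy' hs
    have k2 := bp_kernel_le l x y t hl hx hy' ht
    have q1 := bpq_nonneg l |z| y s hz0 hy' hs
    have q2 := bpq_nonneg l x y t hx hy' ht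
    have a1 : bpq l |z| y s ≤ ((s ^ 2)⁻¹) ^ (l + 1 / 2) := by
      refine (bpq_le l |z| y s hl hz0 hy' hs).trans ?_
      refine Real.rpow_le_rpow (by positivity) ?_ (by positivity)
      exact inv_anti₀ (by positivity) (by nlinarith [sq_nonneg (|z| - y)])
    have b2 := bpq_le' l x y t hl hx hy' ht
    rw [Real.norm_of_nonneg (mul_nonneg n1 n2)]
    have e : (|z| * y) ^ l * (x * y) ^ l = (x * |z|) ^ l * (y ^ 2) ^ l := by
      rw [← Real.mul_rpow (by positivity) (by positivity),
        ← Real.mul_rpow (by positivity) (by positivity)]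
      congr 1; ring
    calc _ ≤ (bpC l * (|z| * y) ^ l * bpq l |z| y s) * (bpC l * (x * y) ^ l * bpq l x y t) := by
          gcongr
      _ = bpC l ^ 2 * ((|z| * y) ^ l * (x * y) ^ l) * (bpq l |z| y s * bpq l x y t) := by ring
      _ = bpC l ^ 2 * (x * |z|) ^ l * bpq l |z| y s * ((y ^ 2) ^ l * bpq l x y t) := by
          rw [e]; ring
      _ ≤ _ := by gcongr
  · exact ((bp_lorentz x t ht).1.const_mul _).integrableOn
  · refine Filter.Eventually.of_forall fun y => ?_
    refine Continuous.continuousAt ?_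
    exact (c1.comp (continuous_abs.prodMk continuous_const)).mul continuous_const

lemma bp_sup_meas (l x t : ℝ) (hl : 0 < l) (hx : 0 ≤ x) (ht : 0 < t) :
    Measurable (fun z : ℝ => ⨆ s : Ioi (0:ℝ), |∫ y in Ioi (0:ℝ),
      besselPoissonKernel l |z| y (s : ℝ) * besselPoissonKernel l x y t|) := by
  refine LowerSemicontinuous.measurable (lowerSemicontinuous_ciSup (fun z => ?_) fun s => ?_)
  · refine ⟨bpC l ^ 2 * (x * |z|) ^ l * (8 / (t ^ 2 + (x - |z|) ^ 2)) ^ (l + 1 / 2) * (2 * π), ?_⟩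
    rintro _ ⟨s, rfl⟩
    exact bp_conv_le l x |z| s t hl hx (abs_nonneg z) s.2 ht
  · exact (bp_conv_cont l x s t hl hx s.2 ht).abs.lowerSemicontinuous

/-- The final majorant, pointwise. -/
lemma bp_major (l x z t : ℝ) (hl : 0 < l) (hx : 0 < x) (hz : 0 < z) (ht : 0 < t) :
    (x * z) ^ l * (8 / (t ^ 2 + (x - z) ^ 2)) ^ (l + 1 / 2) ≤
      8 ^ (l + 1 / 2) * 2 ^ l * ((x / t) ^ l + (x / t) ^ (2 * l)) * t⁻¹ *
        (1 + ((x - z) / t) ^ 2) ^ (-(l + 1) / 2) := by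
  set r := x / t with hr
  set u := (x - z) / t with hu
  have hr0 : 0 < r := by positivity
  have ex : x = r * t := by rw [hr]; field_simp
  have eu : x - z = u * t := by rw [hu]; field_simp
  have ez : z = (r - u) * t := by linear_combination ex - eu
  have hru : 0 < r - u := by
    by_contra hcon
    push Not at hcon
    nlinarith
  set B := 1 + u ^ 2 with hB
  have hB1 : 1 ≤ B := by nlinarith [sq_nonneg u]
  have hB0 : 0 < B := by linarith
  have e1 : (8 / (t ^ 2 + (x - z) ^ 2)) ^ (l + 1 / 2) =
      8 ^ (l + 1 / 2) * ((t ^ 2) ^ (l + 1 / 2))⁻¹ * (B ^ (l + 1 / 2))⁻¹ := by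
    rw [eu, show t ^ 2 + (u * t) ^ 2 = t ^ 2 * B by rw [hB]; ring,
      Real.div_rpow (by norm_num) (by positivity), Real.mul_rpow (by positivity) hB0.le]
    field_simp
  have e2 : (x * z) ^ l = r ^ l * (r - u) ^ l * (t ^ 2) ^ l := by
    rw [← Real.mul_rpow hr0.le hru.le, ← Real.mul_rpow (by positivity) (by positivity)]
    congr 1
    rw [ez, ex]
    ring
  have e3 : (t ^ 2) ^ (l + 1 / 2) = (t ^ 2) ^ l * t := by
    rw [Real.rpow_add (by positivity), ← Real.sqrt_eq_rpow, Real.sqrt_sq ht.le]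
  have hsB : |u| ≤ B ^ (1 / 2 : ℝ) := by
    rw [← Real.sqrt_eq_rpow]
    exact Real.abs_le_sqrt (by rw [hB]; linarith)
  have hsB1 : 1 ≤ B ^ (1 / 2 : ℝ) := Real.one_le_rpow hB1 (by norm_num)
  have h4 : (r - u) ^ l ≤ 2 ^ l * (1 + r ^ l) * B ^ (l / 2) := by
    have hm : r - u ≤ 2 * max r 1 * B ^ (1 / 2 : ℝ) := by
      have := neg_abs_le u
      have m1 := le_max_left r 1
      have m2 := le_max_right r 1
      nlinarith
    calc (r - u) ^ l ≤ (2 * max r 1 * B ^ (1 / 2 : ℝ)) ^ l := Real.rpow_le_rpow hru.le hm hl.le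
      _ = 2 ^ l * (max r 1) ^ l * B ^ (l / 2) := by
        rw [Real.mul_rpow (by positivity) (by positivity),
          Real.mul_rpow (by positivity) (by positivity), ← Real.rpow_mul hB0.le]
        congr 2; ring
      _ ≤ _ := by
        gcongr
        rcases max_cases r 1 with ⟨h, _⟩ | ⟨h, _⟩
        · rw [h]; linarith
        · rw [h, Real.one_rpow]; linarith [Real.rpow_pos_of_pos hr0 l]
  have e5 : B ^ (-(l + 1) / 2) = B ^ (l / 2) * (B ^ (l + 1 / 2))⁻¹ := by
    rw [← Real.rpow_neg hB0.le, ← Real.rpow_add hB0]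
    congr 1; ring
  have e6 : r ^ (2 * l) = r ^ l * r ^ l := by
    rw [← Real.rpow_add hr0]; congr 1; ring
  have hT : 0 < (t ^ 2) ^ l := by positivity
  rw [e1, e2, e3, e5, e6]
  calc _ = 8 ^ (l + 1 / 2) * r ^ l * t⁻¹ * (B ^ (l + 1 / 2))⁻¹ * (r - u) ^ l := by
        field_simp
    _ ≤ 8 ^ (l + 1 / 2) * r ^ l * t⁻¹ * (B ^ (l + 1 / 2))⁻¹ *
        (2 ^ l * (1 + r ^ l) * B ^ (l / 2)) := by gcongr
    _ = _ := by ring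

lemma bp_bracket (l x t : ℝ) (hl : 0 < l) (ht : 0 < t) :
    Integrable (fun z => (1 + ((x - z) / t) ^ 2) ^ (-(l + 1) / 2)) ∧
    ∫ z, (1 + ((x - z) / t) ^ 2) ^ (-(l + 1) / 2) =
      t * ∫ u : ℝ, (1 + u ^ 2) ^ (-(l + 1) / 2) := by
  have h0 : Integrable (fun u : ℝ => (1 + u ^ 2) ^ (-(l + 1) / 2)) := by
    have := integrable_rpow_neg_one_add_norm_sq (E := ℝ) (μ := volume) (r := l + 1)
      (by simpa using hl)
    simpa using this
  have i1 : Integrable (fun u => (1 + (u / t) ^ 2) ^ (-(l + 1) / 2)) := h0.comp_div ht.ne'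
  refine ⟨i1.comp_sub_left x, ?_⟩
  rw [integral_sub_left_eq_self (fun u => (1 + (u / t) ^ 2) ^ (-(l + 1) / 2)) volume x,
    Measure.integral_comp_div (fun u => (1 + u ^ 2) ^ (-(l + 1) / 2)) t, abs_of_pos ht,
    smul_eq_mul]

/-- For every `x, t ∈ (0,∞)`, `P_t^λ(x,·) ∈ H¹_o(ℝ)`: the maximal function
`z ↦ sup_{s>0} |P_s^λ[P_t^λ(x,·)](z)|` is integrable on `(0,∞)` with
`∫₀^∞ sup_{s>0} |P_s^λ[P_t^λ(x,·)](z)| dz ≤ C((x/t)^{2λ+1} + (x/t)^λ)`. -/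
theorem statement13 (l : ℝ) (hl : 0 < l) :
    ∃ C > 0, ∀ x t : ℝ, 0 < x → 0 < t →
      IntegrableOn (fun z => ⨆ s : Ioi (0:ℝ),
        |∫ y in Ioi (0:ℝ), besselPoissonKernel l z y (s : ℝ) * besselPoissonKernel l x y t|)
        (Ioi (0:ℝ)) ∧
      (∫ z in Ioi (0:ℝ), ⨆ s : Ioi (0:ℝ),
        |∫ y in Ioi (0:ℝ), besselPoissonKernel l z y (s : ℝ) * besselPoissonKernel l x y t|)
        ≤ C * ((x / t) ^ (2 * l + 1) + (x / t) ^ l) := by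
  have hC := bpC_pos l hl
  set I : ℝ := ∫ u : ℝ, (1 + u ^ 2) ^ (-(l + 1) / 2) with hI
  have hI0 : 0 ≤ I := integral_nonneg fun u => by positivity
  set D : ℝ := bpC l ^ 2 * (8 ^ (l + 1 / 2) * 2 ^ l) * (2 * π) with hD
  have hD0 : 0 < D := by positivity
  refine ⟨2 * D * (I + 1), by positivity, fun x t hx ht => ?_⟩
  set r := x / t with hr
  have hr0 : 0 < r := by positivity
  set H : ℝ → ℝ := fun z => ⨆ s : Ioi (0:ℝ),
        |∫ y in Ioi (0:ℝ), besselPoissonKernel l z y (s : ℝ) * besselPoissonKernel l x y t|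
    with hH
  obtain ⟨ib, vb⟩ := bp_bracket l x t hl ht
  have hH0 : ∀ z, 0 ≤ H z := fun z => Real.iSup_nonneg fun s => abs_nonneg _
  set g : ℝ → ℝ := fun z => D * (r ^ l + r ^ (2 * l)) * t⁻¹ *
    (1 + ((x - z) / t) ^ 2) ^ (-(l + 1) / 2) with hg
  have hgi : Integrable g := ib.const_mul _
  have hg0 : ∀ z, 0 ≤ g z := fun z => by simp only [hg]; positivity
  have hle : ∀ z ∈ Ioi (0:ℝ), H z ≤ g z := by
    intro z hz
    have : Nonempty (Ioi (0:ℝ)) := ⟨⟨1, by simp⟩⟩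
    refine ciSup_le fun s => ?_
    refine (bp_conv_le l x z s t hl hx.le (le_of_lt hz) s.2 ht).trans ?_
    have h := bp_major l x z t hl hx hz ht
    calc _ = bpC l ^ 2 * (2 * π) *
          ((x * z) ^ l * (8 / (t ^ 2 + (x - z) ^ 2)) ^ (l + 1 / 2)) := by ring
      _ ≤ bpC l ^ 2 * (2 * π) * _ := mul_le_mul_of_nonneg_left h (by positivity)
      _ = g z := by simp only [hg, hD, hr]; ring
  have hae : ∀ᵐ z ∂(volume.restrict (Ioi (0:ℝ))), H z ≤ g z :=
    (ae_restrict_iff' measurableSet_Ioi).2 (Filter.Eventually.of_forall hle)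
  have hm : AEStronglyMeasurable H (volume.restrict (Ioi (0:ℝ))) := by
    refine (bp_sup_meas l x t hl hx.le ht).aestronglyMeasurable.congr ?_
    refine (ae_restrict_iff' measurableSet_Ioi).2 (Filter.Eventually.of_forall fun z hz => ?_)
    simp only [hH, abs_of_pos (show (0:ℝ) < z from hz)]
  refine ⟨?_, ?_⟩
  · refine Integrable.mono' hgi.integrableOn hm ?_
    filter_upwards [hae] with z hz
    rwa [Real.norm_of_nonneg (hH0 z)]
  · have hpow : r ^ (2 * l) ≤ r ^ (2 * l + 1) + r ^ l := by
      have p1 : 0 < r ^ (2 * l + 1) := by positivity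
      have p2 : 0 < r ^ l := by positivity
      rcases le_total 1 r with h | h
      · have := Real.rpow_le_rpow_of_exponent_le h (show 2 * l ≤ 2 * l + 1 by linarith)
        linarith
      · have := Real.rpow_le_rpow_of_exponent_ge hr0 h (show l ≤ 2 * l by linarith)
        linarith
    calc (∫ z in Ioi (0:ℝ), H z) ≤ ∫ z in Ioi (0:ℝ), g z :=
          integral_mono_of_nonneg (Filter.Eventually.of_forall hH0) hgi.integrableOn hae
      _ ≤ ∫ z, g z := setIntegral_le_integral hgi (Filter.Eventually.of_forall hg0)
      _ = D * (r ^ l + r ^ (2 * l)) * I := by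
          simp only [hg]
          rw [integral_const_mul, vb, ← hI]
          field_simp
      _ ≤ D * (2 * (r ^ (2 * l + 1) + r ^ l)) * (I + 1) := by
          have p1 : 0 < r ^ (2 * l + 1) := by positivity
          gcongr
          · linarith
          · linarith
      _ = _ := by ring
end
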